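/- Let q ≥ 2 be an integer and let U be a q-step kernel. If U' is a kernel such that t(H,U') = t(H,U) for every finite simple graph H with at most 4q²−q vertices, then U and U' are weakly isomorphic. -/

import Mathlib

open MeasureTheory
open scoped BigOperators Classical

noncomputable section

abbrev I01 : Type := Set.Icc (0 : ℝ) 1

/-- A kernel: a bounded measurable symmetric function on `[0,1]²`. -/
structure GKernel where
  toFun : I01 → I01 → ℝ
  measurable' : Measurable (Function.uncurry toFun)
  bounded' : ∃ C : ℝ, ∀ x y, |toFun x y| ≤ C
  symm' : ∀ x y, toFun x y = toFun y x

/-- A graphon is a kernel with values in `[0,1]`. -/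
def GKernel.IsGraphon (U : GKernel) : Prop :=
  ∀ x y, U.toFun x y ∈ Set.Icc (0 : ℝ) 1

/-- Homomorphism density of a finite simple graph in a kernel. -/
def homDensity {n : ℕ} (H : SimpleGraph (Fin n)) (U : GKernel) : ℝ :=
  ∫ x : Fin n → I01,
    ∏ e ∈ (Set.toFinite H.edgeSet).toFinset,
      Sym2.lift ⟨fun u v => U.toFun (x u) (x v), fun _ _ => U.symm' _ _⟩ e

/-- Two kernels are weakly isomorphic if all homomorphism densities coincide. -/
def WeaklyIsomorphic (U U' : GKernel) : Prop :=
  ∀ (n : ℕ) (H : SimpleGraph (Fin n)), homDensity H U = homDensity H U'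

/-- `A` is a partition of `[0,1]` into `q` measurable parts of positive measure
on whose pairwise products `U` is constant. -/
def IsStepPartition (U : GKernel) {q : ℕ} (A : Fin q → Set I01) : Prop :=
  (∀ i, MeasurableSet (A i)) ∧
  (∀ i, 0 < volume (A i)) ∧
  Pairwise (fun i j => Disjoint (A i) (A j)) ∧
  (⋃ i, A i) = Set.univ ∧
  (∀ i j, ∃ c : ℝ, ∀ x ∈ A i, ∀ y ∈ A j, U.toFun x y = c)

def HasStepPartition (U : GKernel) (q : ℕ) : Prop :=
  ∃ A : Fin q → Set I01, IsStepPartition U A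

/-- A `q`-step kernel: a step partition into `q` parts exists but none into `q - 1` parts. -/
def IsStepKernel (U : GKernel) (q : ℕ) : Prop :=
  HasStepPartition U q ∧ ¬ HasStepPartition U (q - 1)

/-- The degree of a vertex `x` in a kernel. -/
def GKernel.degree (U : GKernel) (x : I01) : ℝ := ∫ y : I01, U.toFun x y

/-- Density of a rooted graph (roots `R`, non-root vertices `Fin b`) in a kernel,
for a given choice `x` of the roots. -/
def rootedDensity {R : Type} [Fintype R] {b : ℕ}
    (H : SimpleGraph (R ⊕ Fin b)) (U : GKernel) (x : R → I01) : ℝ :=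
  ∫ y : Fin b → I01,
    ∏ e ∈ (Set.toFinite H.edgeSet).toFinset,
      Sym2.lift ⟨fun u v => U.toFun (Sum.elim x y u) (Sum.elim x y v),
        fun _ _ => U.symm' _ _⟩ e

/-- `U` takes the constant value `v` on `A i × A j`. -/
def PartDensityIs (U : GKernel) {q : ℕ} (A : Fin q → Set I01) (i j : Fin q) (v : ℝ) : Prop :=
  ∀ x ∈ A i, ∀ y ∈ A j, U.toFun x y = v

/-- A set of pairwise vertex-disjoint edges. -/
def IsMatchingSet {V : Type} (S : Set (Sym2 V)) : Prop :=
  (∀ e ∈ S, ¬ e.IsDiag) ∧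
  ∀ e ∈ S, ∀ f ∈ S, e ≠ f → ∀ v : V, ¬ (v ∈ e ∧ v ∈ f)

/-- The edges of `S` with both endpoints in `V_i ∪ V_j`, where `V_l` is the set of
vertices with first coordinate `l`. -/
def EdgesIn {q : ℕ} {s : Fin q → ℕ} (S : Set (Sym2 ((l : Fin q) × Fin (s l))))
    (i j : Fin q) : Set (Sym2 ((l : Fin q) × Fin (s l))) :=
  {e ∈ S | ∀ v ∈ e, v.1 = i ∨ v.1 = j}

/-! ### Multi-affine polynomials in the edge variables -/

def ev {V Ω : Type*} (W : Ω → Ω → ℝ) (x : V → Ω) (e : Sym2 V) : ℝ :=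
  Sym2.lift ⟨fun u v => (W (x u) (x v) + W (x v) (x u)) / 2, by intros; ring⟩ e

lemma ev_mk {V Ω : Type*} {W : Ω → Ω → ℝ} (hW : ∀ x y, W x y = W y x) (x : V → Ω) (u v : V) :
    ev W x s(u, v) = W (x u) (x v) := by
  simp only [ev, Sym2.lift_mk]
  rw [hW (x v) (x u)]; ring

lemma ev_comp {V Ω κ : Type*} {W : Ω → Ω → ℝ} {M : κ → κ → ℝ} {f : Ω → κ}
    (h : ∀ x y, W x y = M (f x) (f y)) (x : V → Ω) : ev W x = ev M (f ∘ x) := by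
  funext e
  induction e using Sym2.ind with
  | _ u v => simp [ev, h]

def MA {V : Type*} (E : Set (Sym2 V)) (p : MvPolynomial (Sym2 V) ℝ) : Prop :=
  ∀ e, p.degreeOf e ≤ if e ∈ E then 1 else 0

namespace MA
variable {V : Type*} {E F : Set (Sym2 V)} {p r : MvPolynomial (Sym2 V) ℝ}

lemma mono (h : MA E p) (hEF : E ⊆ F) : MA F p := by
  intro e
  refine (h e).trans ?_
  by_cases he : e ∈ E
  · simp [he, hEF he]
  · simp [he]

lemma const (c : ℝ) : MA E (MvPolynomial.C c) := by
  intro e; simp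

lemma X (e : Sym2 V) : MA {e} (MvPolynomial.X e) := by
  intro f
  rw [MvPolynomial.degreeOf_X]
  simp only [Set.mem_singleton_iff]
  split_ifs <;> simp_all

lemma sub (h : MA E p) (h' : MA F r) : MA (E ∪ F) (p - r) := by
  intro e
  refine (MvPolynomial.degreeOf_sub_le e p r).trans (max_le ?_ ?_)
  · exact (h.mono Set.subset_union_left) e
  · exact (h'.mono Set.subset_union_right) e

lemma mul (h : MA E p) (h' : MA F r) (hd : Disjoint E F) : MA (E ∪ F) (p * r) := by
  intro e
  refine (MvPolynomial.degreeOf_mul_le e p r).trans ?_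
  have h1 := h e
  have h2 := h' e
  by_cases hE : e ∈ E
  · have hF : e ∉ F := Set.disjoint_left.1 hd hE
    simp [hE, hF] at *; omega
  · by_cases hF : e ∈ F <;> simp [hE, hF] at * <;> omega

lemma prod {ι : Type*} {s : Finset ι} {E : ι → Set (Sym2 V)} {p : ι → MvPolynomial (Sym2 V) ℝ}
    (h : ∀ i, MA (E i) (p i)) (hd : ∀ i j, i ≠ j → Disjoint (E i) (E j)) :
    MA (⋃ i ∈ s, E i) (∏ i ∈ s, p i) := by
  induction s using Finset.induction_on with
  | empty => simpa using const (V := V) (E := ∅) 1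
  | insert a s ha ih =>
    rw [Finset.prod_insert ha]
    refine ((h a).mul ih ?_).mono (by simp)
    simp only [Set.disjoint_iUnion_right]
    intro j hj
    exact hd _ _ (fun h => ha (h ▸ hj))

end MA

lemma GKernel.ev_mk' (U : GKernel) {V : Type*} (x : V → I01) (u v : V) :
    ev U.toFun x s(u, v) = U.toFun (x u) (x v) := ev_mk U.symm' x u v

lemma homDensity_eq {n : ℕ} (H : SimpleGraph (Fin n)) (U : GKernel) :
    homDensity H U = ∫ x : Fin n → I01, ∏ e ∈ (Set.toFinite H.edgeSet).toFinset, ev U.toFun x e := by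
  unfold homDensity
  congr 1
  funext x
  refine Finset.prod_congr rfl fun e _ => ?_
  induction e using Sym2.ind with
  | _ u v => rw [ev_mk U.symm']; rfl

lemma measurable_ev (U : GKernel) {V : Type*} (e : Sym2 V) :
    Measurable fun x : V → I01 => ev U.toFun x e := by
  induction e using Sym2.ind with
  | _ u v =>
    simp only [U.ev_mk']
    have h : Measurable fun x : V → I01 => (x u, x v) :=
      (measurable_pi_apply u).prodMk (measurable_pi_apply v)
    exact U.measurable'.comp h

lemma bounded_ev (U : GKernel) : ∃ C : ℝ, 0 ≤ C ∧ ∀ (V : Type) (e : Sym2 V) (x : V → I01),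
    |ev U.toFun x e| ≤ C := by
  obtain ⟨C, hC⟩ := U.bounded'
  refine ⟨C, (abs_nonneg _).trans (hC 0 0), ?_⟩
  intro V e x
  induction e using Sym2.ind with
  | _ u v => rw [U.ev_mk']; exact hC _ _

lemma integrable_prod_ev (U : GKernel) {V : Type} [Fintype V] (s : Finset (Sym2 V)) :
    Integrable fun x : V → I01 => ∏ e ∈ s, ev U.toFun x e := by
  obtain ⟨C, hC0, hC⟩ := bounded_ev U
  refine Integrable.of_bound (C := C ^ s.card) ?_ ?_
  · exact (Finset.measurable_prod _ fun e _ => measurable_ev U e).aestronglyMeasurable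
  · refine Filter.Eventually.of_forall fun x => ?_
    rw [Real.norm_eq_abs, Finset.abs_prod]
    rw [← Finset.prod_const]
    exact Finset.prod_le_prod (fun _ _ => abs_nonneg _) fun e _ => hC V e x

lemma measurable_eval (U : GKernel) {V : Type} [Fintype V] (p : MvPolynomial (Sym2 V) ℝ) :
    Measurable fun x : V → I01 => MvPolynomial.eval (ev U.toFun x) p := by
  simp only [MvPolynomial.eval_eq]
  refine Finset.measurable_sum _ fun d _ => ?_
  refine Measurable.const_mul (Finset.measurable_prod _ fun e _ => ?_) _
  exact (measurable_ev U e).pow_const _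

lemma integrable_eval (U : GKernel) {V : Type} [Fintype V] (p : MvPolynomial (Sym2 V) ℝ) :
    Integrable fun x : V → I01 => MvPolynomial.eval (ev U.toFun x) p := by
  obtain ⟨C, hC0, hC⟩ := bounded_ev U
  refine Integrable.of_bound (C := ∑ d ∈ p.support, |MvPolynomial.coeff d p| *
    ∏ i ∈ d.support, C ^ d i) (measurable_eval U p).aestronglyMeasurable ?_
  refine Filter.Eventually.of_forall fun x => ?_
  rw [MvPolynomial.eval_eq, Real.norm_eq_abs]
  refine (Finset.abs_sum_le_sum_abs _ _).trans (Finset.sum_le_sum fun d _ => ?_)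
  rw [abs_mul, Finset.abs_prod]
  refine mul_le_mul_of_nonneg_left (Finset.prod_le_prod (fun _ _ => abs_nonneg _) fun e _ => ?_)
    (abs_nonneg _)
  rw [abs_pow]
  exact pow_le_pow_left₀ (abs_nonneg _) (hC V e x) _

/-- density of a finite set of non-diagonal edges on an arbitrary finite vertex type -/
lemma integral_prod_eq_homDensity (U : GKernel) {V : Type} [Fintype V] {n : ℕ} (φ : V ≃ Fin n)
    (s : Finset (Sym2 V)) (hs : ∀ e ∈ s, ¬ e.IsDiag) :
    ∫ x : V → I01, ∏ e ∈ s, ev U.toFun x e =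
      homDensity (SimpleGraph.fromEdgeSet (Sym2.map φ '' (s : Set (Sym2 V)))) U := by
  rw [homDensity_eq]
  have hmp := volume_measurePreserving_piCongrLeft (fun _ : Fin n => I01) φ
  rw [← hmp.integral_comp (MeasurableEquiv.measurableEmbedding _)]
  congr 1
  funext x
  have hfin : (Set.toFinite (SimpleGraph.fromEdgeSet (Sym2.map φ '' (s : Set (Sym2 V)))).edgeSet).toFinset
      = s.image (Sym2.map φ) := by
    ext e
    simp only [Set.Finite.mem_toFinset, SimpleGraph.edgeSet_fromEdgeSet, Finset.mem_image,
      Set.mem_sdiff, Set.mem_image, Finset.mem_coe]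
    constructor
    · rintro ⟨h, -⟩; exact h
    · rintro ⟨f, hf, rfl⟩
      refine ⟨⟨f, hf, rfl⟩, fun hdiag => hs f hf ?_⟩
      induction f using Sym2.ind with
      | _ u v => simpa [Sym2.mk_isDiag_iff] using hdiag
  rw [hfin, Finset.prod_image (fun a _ b _ h => Sym2.map.injective φ.injective h)]
  refine Finset.prod_congr rfl fun e _ => ?_
  induction e using Sym2.ind with
  | _ u v =>
    rw [Sym2.map_mk, U.ev_mk', U.ev_mk']
    have (w : V) : (MeasurableEquiv.piCongrLeft (fun _ : Fin n => I01) φ) x (φ w) = x w := by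
      simp [MeasurableEquiv.coe_piCongrLeft]
    simp [this]

lemma key_agree {U U' : GKernel} {N : ℕ}
    (hagree : ∀ n : ℕ, n ≤ N → ∀ H : SimpleGraph (Fin n), homDensity H U' = homDensity H U)
    {V : Type} [Fintype V] (hV : Fintype.card V ≤ N) {E : Set (Sym2 V)}
    (hE : ∀ e ∈ E, ¬ e.IsDiag) {p : MvPolynomial (Sym2 V) ℝ} (hp : MA E p) :
    ∫ x : V → I01, MvPolynomial.eval (ev U'.toFun x) p =
      ∫ x : V → I01, MvPolynomial.eval (ev U.toFun x) p := by
  have hd : ∀ d ∈ p.support, ∀ e ∈ d.support, d e = 1 ∧ e ∈ E := by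
    intro d hd e he
    have h1 := MvPolynomial.monomial_le_degreeOf e hd
    have h2 := hp e
    have h3 : d e ≠ 0 := by simpa using he
    by_cases heE : e ∈ E
    · simp [heE] at h2; exact ⟨by omega, heE⟩
    · simp [heE] at h2; omega
  have key : ∀ W : GKernel, ∫ x : V → I01, MvPolynomial.eval (ev W.toFun x) p =
      ∑ d ∈ p.support, MvPolynomial.coeff d p *
        ∫ x : V → I01, ∏ e ∈ d.support, ev W.toFun x e := by
    intro W
    have : ∀ x : V → I01, MvPolynomial.eval (ev W.toFun x) p =
        ∑ d ∈ p.support, MvPolynomial.coeff d p * ∏ e ∈ d.support, ev W.toFun x e := by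
      intro x
      rw [MvPolynomial.eval_eq]
      refine Finset.sum_congr rfl fun d hdd => ?_
      congr 1
      refine Finset.prod_congr rfl fun e he => ?_
      rw [(hd d hdd e he).1, pow_one]
    simp only [this]
    rw [integral_finsetSum _ fun d _ => (integrable_prod_ev W d.support).const_mul _]
    simp only [integral_const_mul]
  rw [key, key]
  refine Finset.sum_congr rfl fun d hdd => ?_
  congr 1
  have hs : ∀ e ∈ d.support, ¬ e.IsDiag := fun e he => hE e (hd d hdd e he).2
  rw [integral_prod_eq_homDensity U' (Fintype.equivFin V) _ hs,
    integral_prod_eq_homDensity U (Fintype.equivFin V) _ hs]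
  exact hagree _ hV _

/-- integrals of functions of a finite partition -/
lemma integral_step {V κ : Type} [Fintype V] [Fintype κ] (π : I01 → κ)
    (hπ : ∀ k, MeasurableSet (π ⁻¹' {k})) (f : (V → κ) → ℝ) :
    ∫ x : V → I01, f (π ∘ x) =
      ∑ σ : V → κ, (∏ v, (volume : Measure I01).real (π ⁻¹' {σ v})) * f σ := by
  let _ : MeasurableSpace κ := ⊤
  have hm : Measurable π := measurable_to_countable' hπ
  have hmap : Measure.map (fun x : V → I01 => fun v => π (x v)) volume =
      Measure.pi (fun _ : V => Measure.map π volume) := by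
    rw [volume_pi]
    have : IsProbabilityMeasure (Measure.map π (volume : Measure I01)) :=
      Measure.isProbabilityMeasure_map hm.aemeasurable
    exact Measure.pi_map_pi (fun _ => hm.aemeasurable)
  have hm' : Measurable (fun x : V → I01 => fun v => π (x v)) :=
    measurable_pi_lambda _ fun v => hm.comp (measurable_pi_apply v)
  have : IsProbabilityMeasure (Measure.map π (volume : Measure I01)) :=
      Measure.isProbabilityMeasure_map hm.aemeasurable
  have h1 : ∫ x : V → I01, f (π ∘ x) = ∫ σ, f σ ∂(Measure.pi (fun _ : V => Measure.map π volume)) := by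
    rw [← hmap, integral_map hm'.aemeasurable]
    · rfl
    · exact (measurable_of_finite f).aestronglyMeasurable
  rw [h1, integral_fintype Integrable.of_finite]
  refine Finset.sum_congr rfl fun σ _ => ?_
  rw [smul_eq_mul]
  congr 1
  rw [Measure.real, ← Set.univ_pi_singleton, Measure.pi_pi, ENNReal.toReal_prod]
  refine Finset.prod_congr rfl fun v _ => ?_
  rw [Measure.map_apply hm (measurableSet_singleton _)]
  rfl

/-! ### Finite weighted graphs -/

lemma rot_const {n : ℕ} {α : Type*} (g : Fin n → α) (h : ∀ s, g (finRotate n s) = g s) :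
    ∀ s t, g s = g t := by
  have key : ∀ (k : ℕ) (hk : k < n), g ⟨k, hk⟩ = g ⟨0, by omega⟩ := by
    intro k
    induction k with
    | zero => intro _; rfl
    | succ k ih =>
      intro hk
      rw [← ih (by omega), ← h ⟨k, by omega⟩]
      congr 1
      cases n with
      | zero => omega
      | succ m => rw [finRotate_of_lt (by omega)]
  intro s t
  rw [show s = ⟨s.1, s.2⟩ from rfl, show t = ⟨t.1, t.2⟩ from rfl, key s.1 s.2, key t.1 t.2]

lemma layers {q c : ℕ} (hc : 0 < c) {κ : Type} [Fintype κ] (hκ : Fintype.card κ ≤ q)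
    (f : Fin q × Fin c → κ) (h0 : ∀ i j s, j < i → f (i, s) ≠ f (j, s))
    (h1 : ∀ i j s, i < j → f (i, s) ≠ f (j, finRotate c s)) :
    ∃ τ : Fin q ≃ κ, ∀ i s, f (i, s) = τ i := by
  have inj : ∀ s, Function.Injective fun i => f (i, s) := by
    intro s i j hij
    rcases lt_trichotomy i j with h | h | h
    · exact absurd hij.symm (h0 j i s h)
    · exact h
    · exact absurd hij (h0 i j s h)
  have bij : ∀ s, Function.Bijective fun i => f (i, s) := by
    intro s
    rw [Fintype.bijective_iff_injective_and_card]
    refine ⟨inj s, le_antisymm ?_ (by simpa using hκ)⟩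
    exact Fintype.card_le_of_injective _ (inj s)
  have key : ∀ (n : ℕ) (i : Fin q), i.1 = n → ∀ s, f (i, finRotate c s) = f (i, s) := by
    intro n
    induction n using Nat.strong_induction_on with
    | _ n ih =>
      intro i hi s
      obtain ⟨j, hj⟩ := (bij (finRotate c s)).2 (f (i, s))
      simp only at hj
      rcases lt_trichotomy i j with h | h | h
      · exact absurd hj.symm (h1 i j s h)
      · rw [h] at hj ⊢; exact hj
      · have h2 := ih j.1 (by omega) j rfl s
        rw [h2] at hj
        exact absurd hj.symm (h0 i j s h)
  refine ⟨Equiv.ofBijective _ (bij ⟨0, hc⟩), fun i s => ?_⟩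
  exact rot_const (fun s => f (i, s)) (fun s => key i.1 i rfl s) s ⟨0, hc⟩

abbrev Off (q : ℕ) : Type := {p : Fin q × Fin q // p.1 ≠ p.2}
abbrev Tri (c : ℕ) : Type := (t : Fin c) × Fin t.1
abbrev Core (q : ℕ) : Type := Fin q × Fin (2 * q)
abbrev Vtx (q : ℕ) (Λ : Type) : Type := Core q ⊕ (Off q ⊕ Λ)

def Tri.lo {c : ℕ} (t : Tri c) : Fin c := ⟨t.2.1, t.2.2.trans t.1.2⟩
def Tri.hi {c : ℕ} (t : Tri c) : Fin c := t.1

lemma Tri.lt {c : ℕ} (t : Tri c) : t.lo < t.hi := t.2.2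

lemma Tri.ext' {c : ℕ} {t t' : Tri c} (h : t.lo = t'.lo) (h' : t.hi = t'.hi) : t = t' := by
  obtain ⟨a, b⟩ := t
  obtain ⟨a', b'⟩ := t'
  simp only [Tri.hi] at h'
  subst h'
  simp only [Tri.lo, Fin.mk.injEq] at h
  congr 1
  exact Fin.ext h

lemma card_Tri (c : ℕ) : Fintype.card (Tri c) * 2 = c * (c - 1) := by
  rw [Fintype.card_sigma]
  simp only [Fintype.card_fin]
  rw [Fin.sum_univ_eq_sum_range (fun i => i), Finset.sum_range_id_mul_two]

lemma card_Off (q : ℕ) : Fintype.card (Off q) + q = q * q := by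
  have h : Fintype.card {p : Fin q × Fin q // p.1 = p.2} = q := by
    rw [Fintype.card_congr (⟨fun p => p.1.1, fun i => ⟨(i, i), rfl⟩, fun p => by
      obtain ⟨⟨a, b⟩, h⟩ := p
      simp only at h
      subst h
      rfl, fun i => rfl⟩ : {p : Fin q × Fin q // p.1 = p.2} ≃ Fin q), Fintype.card_fin]
  have h2 := Fintype.card_subtype_compl (fun p : Fin q × Fin q => p.1 = p.2)
  rw [h, Fintype.card_prod, Fintype.card_fin] at h2
  have h3 : q ≤ q * q := Nat.le_mul_self q
  have h4 : Fintype.card (Off q) = q * q - q := by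
    rw [← h2]
  omega

lemma card_Vtx {q : ℕ} {Λ : Type} [Fintype Λ] (h : Fintype.card Λ ≤ q ^ 2) :
    Fintype.card (Vtx q Λ) ≤ 4 * q ^ 2 - q := by
  have h1 := card_Off q
  have h2 : Fintype.card (Vtx q Λ) = 2 * (q * q) + (Fintype.card (Off q) + Fintype.card Λ) := by
    rw [Fintype.card_sum, Fintype.card_sum, Fintype.card_prod, Fintype.card_fin, Fintype.card_fin]
    ring
  rw [h2]
  have h3 : q ^ 2 = q * q := by ring
  rw [h3] at h ⊢
  omega

def sh {q : ℕ} (p : Off q) (s : Fin (2 * q)) : Fin (2 * q) :=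
  if p.1.1 < p.1.2 then finRotate _ s else s

lemma sh_inj {q : ℕ} (p : Off q) : Function.Injective (sh p) := by
  intro s t h
  unfold sh at h
  split_ifs at h with h1
  · exact (finRotate _).injective h
  · exact h

def certP (q : ℕ) (Λ : Type) : MvPolynomial (Sym2 (Vtx q Λ)) ℝ :=
  ∏ ps : Off q × Fin (2 * q),
    (MvPolynomial.X s(Sum.inl (ps.1.1.1, ps.2), Sum.inr (Sum.inl ps.1)) -
      MvPolynomial.X s(Sum.inl (ps.1.1.2, sh ps.1 ps.2), Sum.inr (Sum.inl ps.1)))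

def valP {q : ℕ} (Λ : Type) (ν : Fin q → Fin q → Tri (2 * q) → ℝ) :
    MvPolynomial (Sym2 (Vtx q Λ)) ℝ :=
  ∏ z : (Fin q × Fin q) × Tri (2 * q),
    (MvPolynomial.X s(Sum.inl (z.1.1, z.2.lo), Sum.inl (z.1.2, z.2.hi)) -
      MvPolynomial.C (ν z.1.1 z.1.2 z.2))

def emb {q : ℕ} (j : Fin q) : Fin (2 * q) := Fin.castLE (by omega) j

lemma emb_inj {q : ℕ} : Function.Injective (emb (q := q)) := fun _ _ h => Fin.castLE_injective _ h

def wtP {q : ℕ} {Λ : Type} [Fintype Λ] (w : Fin q → Fin q → Fin q) (m : Fin q → Fin q → ℝ)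
    (i : Λ → Fin q) (k : Λ → ℝ) : MvPolynomial (Sym2 (Vtx q Λ)) ℝ :=
  ∏ l : Λ, ((∏ j ∈ Finset.univ.erase (i l),
    (MvPolynomial.X s(Sum.inl (w (i l) j, emb j), Sum.inr (Sum.inr l)) -
      MvPolynomial.C (m (i l) j))) - MvPolynomial.C (k l))

def EC (q : ℕ) (Λ : Type) : Set (Sym2 (Vtx q Λ)) :=
  {e | ∃ a p, e = s(Sum.inl a, Sum.inr (Sum.inl p))}
def EV (q : ℕ) (Λ : Type) : Set (Sym2 (Vtx q Λ)) :=
  {e | ∃ a b, a ≠ b ∧ e = s(Sum.inl a, Sum.inl b)}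
def EW (q : ℕ) (Λ : Type) : Set (Sym2 (Vtx q Λ)) :=
  {e | ∃ a l, e = s(Sum.inl a, Sum.inr (Sum.inr l))}

lemma MA_certP (q : ℕ) (Λ : Type) : MA (EC q Λ) (certP q Λ) := by
  refine MA.mono (MA.prod (fun ps => (MA.X _).sub (MA.X _)) ?_) ?_
  · rintro ⟨p, s⟩ ⟨p', s'⟩ hne
    rw [Set.disjoint_left]
    rintro e he he'
    apply hne
    simp only [Set.union_singleton, Set.mem_insert_iff, Set.mem_singleton_iff] at he he'
    have hp := p.2
    rcases he with rfl | rfl <;> rcases he' with he' | he' <;>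
      simp only [Sym2.eq_iff, Sum.inl.injEq, Sum.inr.injEq, Prod.mk.injEq, reduceCtorEq, false_and,
        or_false] at he'
    · obtain ⟨⟨-, h2⟩, rfl⟩ := he'
      rw [sh_inj _ h2]
    · obtain ⟨⟨h1, -⟩, rfl⟩ := he'
      exact absurd h1.symm hp
    · obtain ⟨⟨h1, -⟩, rfl⟩ := he'
      exact absurd h1 hp
    · obtain ⟨⟨-, h2⟩, rfl⟩ := he'
      rw [h2]
  · intro e he
    simp only [Finset.mem_univ, Set.iUnion_true, Set.mem_iUnion, Set.union_singleton,
      Set.mem_insert_iff, Set.mem_singleton_iff] at he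
    obtain ⟨ps, rfl | rfl⟩ := he <;> exact ⟨_, _, rfl⟩

lemma MA_valP {q : ℕ} (Λ : Type) (ν : Fin q → Fin q → Tri (2 * q) → ℝ) :
    MA (EV q Λ) (valP Λ ν) := by
  refine MA.mono (MA.prod (fun ps => (MA.X _).sub (MA.const (E := ∅) _)) ?_) ?_
  · rintro ⟨⟨i, j⟩, t⟩ ⟨⟨i', j'⟩, t'⟩ hne
    rw [Set.disjoint_left]
    rintro e he he'
    apply hne
    simp only [Set.union_empty, Set.mem_singleton_iff] at he he'
    subst he
    have h1 := t.lt
    have h2 := t'.lt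
    simp only [Sym2.eq_iff, Sum.inl.injEq, Prod.mk.injEq] at he'
    rcases he' with ⟨⟨rfl, h3⟩, rfl, h4⟩ | ⟨⟨rfl, h3⟩, rfl, h4⟩
    · rw [Tri.ext' h3 h4]
    · rw [h3, h4] at h1
      exact absurd h1 (lt_asymm h2)
  · intro e he
    simp only [Finset.mem_univ, Set.iUnion_true, Set.mem_iUnion, Set.union_empty,
      Set.mem_singleton_iff] at he
    obtain ⟨z, rfl⟩ := he
    refine ⟨_, _, ?_, rfl⟩
    intro h
    exact z.2.lt.ne (Prod.ext_iff.1 h).2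

lemma MA_wtP {q : ℕ} {Λ : Type} [Fintype Λ] (w : Fin q → Fin q → Fin q) (m : Fin q → Fin q → ℝ)
    (i : Λ → Fin q) (k : Λ → ℝ) : MA (EW q Λ) (wtP w m i k) := by
  have h1 : ∀ l : Λ, MA {e : Sym2 (Vtx q Λ) | ∃ a, e = s(Sum.inl a, Sum.inr (Sum.inr l))}
      ((∏ j ∈ Finset.univ.erase (i l),
    (MvPolynomial.X s(Sum.inl (w (i l) j, emb j), Sum.inr (Sum.inr l)) -
      MvPolynomial.C (m (i l) j))) - MvPolynomial.C (k l)) := by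
    intro l
    refine MA.mono ((MA.prod (fun j => (MA.X _).sub (MA.const (E := ∅) _)) ?_).sub
      (MA.const (E := ∅) _)) ?_
    · intro j j' hne
      rw [Set.disjoint_left]
      rintro e he he'
      apply hne
      simp only [Set.union_empty, Set.mem_singleton_iff] at he he'
      subst he
      simp only [Sym2.eq_iff, Sum.inl.injEq, Prod.mk.injEq, and_true, reduceCtorEq, false_and,
        or_false] at he'
      exact emb_inj he'.2
    · intro e he
      simp only [Set.mem_iUnion, Set.union_empty, Set.mem_singleton_iff] at he
      obtain ⟨j, _, rfl⟩ := he
      exact ⟨_, rfl⟩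
  refine MA.mono (MA.prod h1 ?_) ?_
  · intro l l' hne
    rw [Set.disjoint_left]
    rintro e ⟨a, rfl⟩ ⟨a', h⟩
    apply hne
    simp only [Sym2.eq_iff, Sum.inl.injEq, Sum.inr.injEq, reduceCtorEq, false_and, or_false] at h
    exact h.2
  · intro e he
    simp only [Finset.mem_univ, Set.iUnion_true, Set.mem_iUnion] at he
    obtain ⟨l, a, rfl⟩ := he
    exact ⟨_, _, rfl⟩

lemma MA_full {q : ℕ} {Λ : Type} [Fintype Λ] (ν : Fin q → Fin q → Tri (2 * q) → ℝ)
    (w : Fin q → Fin q → Fin q) (m : Fin q → Fin q → ℝ)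
    (i : Λ → Fin q) (k : Λ → ℝ) :
    MA ((EV q Λ ∪ EC q Λ) ∪ EW q Λ) (valP Λ ν * certP q Λ * wtP w m i k) := by
  refine ((MA_valP Λ ν).mul (MA_certP q Λ) ?_).mul (MA_wtP w m i k) ?_
  · rw [Set.disjoint_left]
    rintro e ⟨a, b, -, rfl⟩ ⟨a', p, h⟩
    simp at h
  · rw [Set.disjoint_left]
    rintro e (⟨a, b, -, rfl⟩ | ⟨a, b, rfl⟩) ⟨a', p, h⟩ <;>
    simp at h

lemma nondiag_full {q : ℕ} {Λ : Type} :
    ∀ e ∈ ((EV q Λ ∪ EC q Λ) ∪ EW q Λ), ¬ e.IsDiag := by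
  rintro e ((⟨a, b, h, rfl⟩ | ⟨a, b, rfl⟩) | ⟨a, b, rfl⟩)
  · simpa using h
  · simp
  · simp

lemma sum_sum_arrow {A B κ : Type} [Fintype A] [Fintype B] [Fintype κ] [DecidableEq A]
    [DecidableEq B] [DecidableEq (A ⊕ B)] (F : (A ⊕ B → κ) → ℝ) :
    ∑ σ, F σ = ∑ f : A → κ, ∑ g : B → κ, F (Sum.elim f g) := by
  rw [← Fintype.sum_prod_type']
  classical
  refine Fintype.sum_equiv (Equiv.sumArrowEquivProdArrow A B κ) _ _ fun σ => ?_
  congr 1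
  funext x
  cases x <;> rfl

lemma sum_prod_arrow {B κ : Type} [Fintype B] [Fintype κ] [DecidableEq B] (h : B → κ → ℝ) :
    ∑ u : B → κ, ∏ p, h p (u p) = ∏ p, ∑ k, h p k := by
  rw [Finset.prod_univ_sum, Fintype.piFinset_univ]

section
variable {q : ℕ} {Λ κ : Type} [Fintype Λ] [Fintype κ]

def term (b : κ → ℝ) (M : κ → κ → ℝ) (ν : Fin q → Fin q → Tri (2 * q) → ℝ)
    (w : Fin q → Fin q → Fin q) (m : Fin q → Fin q → ℝ)
    (i : Λ → Fin q) (k : Λ → ℝ) (f : Core q → κ) : ℝ :=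
  (∏ v, b (f v)) *
  (∏ z : (Fin q × Fin q) × Tri (2 * q),
    (M (f (z.1.1, z.2.lo)) (f (z.1.2, z.2.hi)) - ν z.1.1 z.1.2 z.2)) *
  (∏ p : Off q, ∑ y, b y * ∏ s, (M (f (p.1.1, s)) y - M (f (p.1.2, sh p s)) y)) *
  ∏ l : Λ, ∑ y, b y * ((∏ j ∈ Finset.univ.erase (i l),
    (M (f (w (i l) j, emb j)) y - m (i l) j)) - k l)

lemma sum_eq_term (b : κ → ℝ) (M : κ → κ → ℝ) (hM : ∀ x y, M x y = M y x)
    (ν : Fin q → Fin q → Tri (2 * q) → ℝ)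
    (w : Fin q → Fin q → Fin q) (m : Fin q → Fin q → ℝ)
    (i : Λ → Fin q) (k : Λ → ℝ) :
    ∑ σ : Vtx q Λ → κ, (∏ v, b (σ v)) *
      MvPolynomial.eval (ev M σ) (valP Λ ν * certP q Λ * wtP w m i k) =
    ∑ f : Core q → κ, term b M ν w m i k f := by
  rw [sum_sum_arrow]
  refine Finset.sum_congr rfl fun f _ => ?_
  rw [sum_sum_arrow]
  unfold term
  rw [← sum_prod_arrow, ← sum_prod_arrow]
  conv_rhs => rw [mul_assoc, Finset.sum_mul_sum, Finset.mul_sum]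
  refine Finset.sum_congr rfl fun u _ => ?_
  rw [Finset.mul_sum]
  refine Finset.sum_congr rfl fun y _ => ?_
  simp only [Fintype.prod_sum_type, Sum.elim_inl, Sum.elim_inr, map_mul, valP, certP, wtP, map_prod,
    map_sub, MvPolynomial.eval_X, MvPolynomial.eval_C, ev_mk hM, Finset.prod_mul_distrib]
  rw [Fintype.prod_prod_type' (fun (p : Off q) (s : Fin (2 * q)) =>
    (M (f (p.1.1, s)) (u p) - M (f (p.1.2, sh p s)) (u p)))]
  ring

lemma exists_iso_of_term_ne_zero (hq : 1 ≤ q) (hκ : Fintype.card κ ≤ q)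
    {b : κ → ℝ} (hb : ∀ k, 0 ≤ b k) {M' : κ → κ → ℝ}
    {M : Fin q → Fin q → ℝ}
    {ν : Fin q → Fin q → Tri (2 * q) → ℝ}
    (hν : ∀ i j x y, M' x y ≠ M i j → ∃ t, ν i j t = M' x y)
    {w : Fin q → Fin q → Fin q} {m : Fin q → Fin q → ℝ}
    {i : Λ → Fin q} {k : Λ → ℝ} {f : Core q → κ} (hf : term b M' ν w m i k f ≠ 0) :
    ∃ τ : Fin q ≃ κ, (∀ x, f x = τ x.1) ∧ (∀ i j, M' (τ i) (τ j) = M i j) ∧ (∀ i, 0 < b (τ i)) := by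
  unfold term at hf
  have h4 := right_ne_zero_of_mul hf
  have h' := left_ne_zero_of_mul hf
  have h3 := right_ne_zero_of_mul h'
  have h'' := left_ne_zero_of_mul h'
  have h2 := right_ne_zero_of_mul h''
  have h1 := left_ne_zero_of_mul h''
  clear hf h' h''
  rw [Finset.prod_ne_zero_iff] at h1 h2 h3
  have hd : ∀ (p : Off q) s, f (p.1.1, s) ≠ f (p.1.2, sh p s) := by
    intro p s heq
    apply h3 p (Finset.mem_univ _)
    refine Finset.sum_eq_zero fun y _ => ?_
    rw [Finset.prod_eq_zero (Finset.mem_univ s) (by rw [heq, sub_self]), mul_zero]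
  obtain ⟨τ, hτ⟩ := layers (c := 2 * q) (by omega) hκ f
    (fun i j s hij => by
      have := hd ⟨(i, j), hij.ne'⟩ s
      simpa [sh, not_lt.2 hij.le] using this)
    (fun i j s hij => by
      have := hd ⟨(i, j), hij.ne⟩ s
      simpa [sh, hij] using this)
  refine ⟨τ, fun x => hτ x.1 x.2, ?_, ?_⟩
  · intro i j
    by_contra hne
    obtain ⟨t, ht⟩ := hν i j _ _ hne
    apply h2 ((i, j), t) (Finset.mem_univ _)
    simp only [hτ]
    rw [ht, sub_self]
  · intro i
    have := h1 (i, ⟨0, by omega⟩) (Finset.mem_univ _)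
    rw [hτ] at this
    exact lt_of_le_of_ne (hb _) this.symm

def kap (M : Fin q → Fin q → ℝ) (w : Fin q → Fin q → Fin q) (i : Fin q) : ℝ :=
  ∏ j ∈ Finset.univ.erase i, (M i (w i j) - M j (w i j))

lemma term_iso {b : κ → ℝ} (hb1 : ∑ k, b k = 1) {M' : κ → κ → ℝ}
    {M : Fin q → Fin q → ℝ} (hM : ∀ x y, M x y = M y x)
    {ν : Fin q → Fin q → Tri (2 * q) → ℝ}
    {w : Fin q → Fin q → Fin q}
    {i : Λ → Fin q} {v : Λ → ℝ} {f : Core q → κ}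
    (τ : Fin q ≃ κ) (hf : ∀ x, f x = τ x.1) (hτ : ∀ i j, M' (τ i) (τ j) = M i j) :
    term b M' ν w (fun i j => M j (w i j)) i (fun l => kap M w (i l) * v l) f =
      (∏ v : Core q, b (τ v.1)) *
      (∏ z : (Fin q × Fin q) × Tri (2 * q), (M z.1.1 z.1.2 - ν z.1.1 z.1.2 z.2)) *
      (∏ p : Off q, ∑ y, b (τ y) * (M p.1.1 y - M p.1.2 y) ^ (2 * q)) *
      ((∏ l, kap M w (i l)) * ∏ l, (b (τ (i l)) - v l)) := by
  unfold term
  simp only [hf, hτ]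
  congr 1
  · congr 1
    refine Finset.prod_congr rfl fun p _ => ?_
    rw [← τ.sum_comp]
    refine Finset.sum_congr rfl fun y _ => ?_
    simp only [hτ, Finset.prod_const, Finset.card_univ, Fintype.card_fin]
  · rw [← Finset.prod_mul_distrib]
    refine Finset.prod_congr rfl fun l _ => ?_
    simp only [mul_sub, Finset.sum_sub_distrib, ← Finset.sum_mul, hb1, one_mul]
    congr 1
    rw [← τ.sum_comp, Finset.sum_eq_single (i l)]
    · rw [mul_comm]
      congr 1
      unfold kap
      refine Finset.prod_congr rfl fun j _ => ?_
      rw [hτ, hM]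
    · intro r _ hr
      rw [Finset.prod_eq_zero (i := r) (by simp [hr]) (by rw [hτ, hM, sub_self]), mul_zero]
    · simp

end

lemma exists_nu {T : Type} [Fintype T] (A : Finset ℝ) (m : ℝ) (hm : m ∉ A)
    (hA : A.card ≤ Fintype.card T) : ∃ ν : T → ℝ, (∀ a ∈ A, ∃ t, ν t = a) ∧ ∀ t, ν t ≠ m := by
  have : Nonempty (A ↪ T) := Function.Embedding.nonempty_of_card_le (by simpa using hA)
  obtain ⟨g⟩ := this
  refine ⟨fun t => if h : ∃ a, g a = t then (h.choose : ℝ) else m + 1, ?_, ?_⟩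
  · intro a ha
    refine ⟨g ⟨a, ha⟩, ?_⟩
    have h : ∃ a', g a' = g ⟨a, ha⟩ := ⟨_, rfl⟩
    simp only [h, dif_pos]
    rw [g.injective h.choose_spec]
  · intro t
    simp only
    split_ifs with h
    · intro heq
      exact hm (heq ▸ h.choose.2)
    · simp

def Vals {κ : Type} [Fintype κ] (M : κ → κ → ℝ) : Finset ℝ :=
  Finset.univ.image fun p : κ × κ => M p.1 p.2

lemma mem_Vals {κ : Type} [Fintype κ] (M : κ → κ → ℝ) (x y : κ) : M x y ∈ Vals M :=
  Finset.mem_image.2 ⟨(x, y), Finset.mem_univ _, rfl⟩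

lemma card_Vals {κ : Type} [Fintype κ] (M : κ → κ → ℝ) (hM : ∀ x y, M x y = M y x) {q : ℕ}
    (hκ : Fintype.card κ ≤ q) : (Vals M).card * 2 ≤ (q + 1) * q := by
  have h : Vals M ⊆ Finset.univ.image fun e : Sym2 κ => ev M id e := by
    intro a ha
    obtain ⟨p, -, rfl⟩ := Finset.mem_image.1 ha
    exact Finset.mem_image.2 ⟨s(p.1, p.2), Finset.mem_univ _, by rw [ev_mk hM]; rfl⟩
  have h1 := (Finset.card_le_card h).trans Finset.card_image_le
  rw [Finset.card_univ, Sym2.card] at h1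
  have h2 : (Fintype.card κ + 1).choose 2 ≤ (q + 1).choose 2 := Nat.choose_le_choose _ (by omega)
  have h3 := Nat.triangle_succ q
  rw [Nat.choose_two_right] at h2
  have h4 : (q + 1).choose 2 * 2 = (q + 1) * q := by
    rw [Nat.choose_two_right]
    exact Nat.div_mul_cancel (by simpa [mul_comm] using (Nat.even_mul_succ_self q).two_dvd)
  rw [Nat.choose_two_right] at h1
  omega

def FAgree (N : ℕ) {κ₁ κ₂ : Type} [Fintype κ₁] [Fintype κ₂] (a : κ₁ → ℝ) (M : κ₁ → κ₁ → ℝ)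
    (b : κ₂ → ℝ) (M' : κ₂ → κ₂ → ℝ) : Prop :=
  ∀ (V : Type) [Fintype V] [DecidableEq V], Fintype.card V ≤ N → ∀ (E : Set (Sym2 V)), (∀ e ∈ E, ¬ e.IsDiag) →
    ∀ p : MvPolynomial (Sym2 V) ℝ, MA E p →
    ∑ σ : V → κ₁, (∏ v, a (σ v)) * MvPolynomial.eval (ev M σ) p =
      ∑ σ : V → κ₂, (∏ v, b (σ v)) * MvPolynomial.eval (ev M' σ) p

lemma lemX {q : ℕ} (hq : 1 ≤ q) {a : Fin q → ℝ} (ha : ∀ i, 0 < a i) (ha1 : ∑ i, a i = 1)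
    {M : Fin q → Fin q → ℝ} (hM : ∀ x y, M x y = M y x)
    (htw : ∀ i j, i ≠ j → ∃ k, M i k ≠ M j k)
    {κ : Type} [Fintype κ] (hκ : Fintype.card κ ≤ q) {b : κ → ℝ} (hb : ∀ i, 0 ≤ b i)
    (hb1 : ∑ i, b i = 1) {M' : κ → κ → ℝ} (hM' : ∀ x y, M' x y = M' y x)
    (hF : FAgree (4 * q ^ 2 - q) a M b M') {Λ : Type} [Fintype Λ] (hΛ : Fintype.card Λ ≤ q ^ 2)
    (i : Λ → Fin q) (v : Λ → ℝ) (hv : ∀ l, a (i l) ≠ v l)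
    (hτ : ∀ τ : Fin q ≃ Fin q, (∀ i j, M (τ i) (τ j) = M i j) →
      ∏ l, (a (τ (i l)) - v l) = 0 ∨ ∏ l, (a (τ (i l)) - v l) = ∏ l, (a (i l) - v l)) :
    ∃ τ : Fin q ≃ κ, (∀ i j, M' (τ i) (τ j) = M i j) ∧ (∀ i, 0 < b (τ i)) ∧
      ∀ l, b (τ (i l)) ≠ v l := by
  -- the separating values
  have hν : ∀ i j, ∃ ν : Tri (2 * q) → ℝ,
      (∀ a ∈ (Vals M ∪ Vals M').erase (M i j), ∃ t, ν t = a) ∧ ∀ t, ν t ≠ M i j := by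
    intro i j
    apply exists_nu _ _ (by simp)
    rw [Finset.card_erase_of_mem (Finset.mem_union_left _ (mem_Vals M i j))]
    have h1 := card_Vals M hM (q := q) (by simp)
    have h2 := card_Vals M' hM' hκ
    have h3 := Finset.card_union_le (Vals M) (Vals M')
    have h4 := card_Tri (2 * q)
    have h5 : (q + 1) * q - 1 ≤ Fintype.card (Tri (2 * q)) := by
      obtain ⟨r, rfl⟩ : ∃ r, q = r + 1 := ⟨q - 1, by omega⟩
      have h6 : 2 * (r + 1) - 1 = 2 * r + 1 := by omega
      rw [h6] at h4
      have h7 : (r + 1 + 1) * (r + 1) ≤ (r + 1) * (2 * r + 1) + 1 := by nlinarith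
      have h8 : Fintype.card (Tri (2 * (r + 1))) = (r + 1) * (2 * r + 1) := by nlinarith
      omega
    omega
  choose ν hν1 hν2 using hν
  have hw : ∀ i j, ∃ k, i ≠ j → M i k ≠ M j k := by
    intro i j
    by_cases h : i = j
    · exact ⟨i, fun h' => absurd h h'⟩
    · obtain ⟨k, hk⟩ := htw i j h
      exact ⟨k, fun _ => hk⟩
  choose w hw using hw
  have hkap : ∀ i, kap M w i ≠ 0 := by
    intro i
    unfold kap
    rw [Finset.prod_ne_zero_iff]
    intro j hj
    exact sub_ne_zero.2 (hw i j (Finset.ne_of_mem_erase hj).symm)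
  have hS := hF (Vtx q Λ) (card_Vtx hΛ) _ nondiag_full _
    (MA_full ν w (fun i j => M j (w i j)) i (fun l => kap M w (i l) * v l))
  rw [sum_eq_term a M hM, sum_eq_term b M' hM'] at hS
  have hνM : ∀ i j x y, M x y ≠ M i j → ∃ t, ν i j t = M x y := fun i j x y h =>
    hν1 i j _ (Finset.mem_erase.2 ⟨h, Finset.mem_union_left _ (mem_Vals M x y)⟩)
  have hνM' : ∀ i j x y, M' x y ≠ M i j → ∃ t, ν i j t = M' x y := fun i j x y h =>
    hν1 i j _ (Finset.mem_erase.2 ⟨h, Finset.mem_union_right _ (mem_Vals M' x y)⟩)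
  -- positivity of the left-hand side
  set V0 : ℝ := ∏ z : (Fin q × Fin q) × Tri (2 * q), (M z.1.1 z.1.2 - ν z.1.1 z.1.2 z.2) with hV0
  set K0 : ℝ := ∏ l, kap M w (i l) with hK0
  set C0 : ℝ := ∏ l, (a (i l) - v l) with hC0
  have hV0' : V0 ≠ 0 := Finset.prod_ne_zero_iff.2 fun z _ => sub_ne_zero.2 (hν2 _ _ _).symm
  have hK0' : K0 ≠ 0 := Finset.prod_ne_zero_iff.2 fun l _ => hkap _
  have hC0' : C0 ≠ 0 := Finset.prod_ne_zero_iff.2 fun l _ => sub_ne_zero.2 (hv l)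
  have hpos1 : ∀ τ : Fin q ≃ Fin q, 0 < ∏ v : Core q, a (τ v.1) := fun τ =>
    Finset.prod_pos fun _ _ => ha _
  have hpos2 : ∀ τ : Fin q ≃ Fin q,
      0 < ∏ p : Off q, ∑ y, a (τ y) * (M p.1.1 y - M p.1.2 y) ^ (2 * q) := by
    intro τ
    refine Finset.prod_pos fun p _ => ?_
    have he : Even (2 * q) := even_two_mul q
    refine Finset.sum_pos' (fun y _ => mul_nonneg (ha _).le (he.pow_nonneg _)) ?_
    obtain ⟨y, hy⟩ := htw p.1.1 p.1.2 p.2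
    refine ⟨y, Finset.mem_univ _, mul_pos (ha _) ?_⟩
    exact he.pow_pos (sub_ne_zero.2 hy)
  have hsq : 0 < (V0 * (K0 * C0)) * (V0 * (K0 * C0)) :=
    mul_self_pos.2 (mul_ne_zero hV0' (mul_ne_zero hK0' hC0'))
  have hL : 0 < ∑ f : Core q → Fin q,
      term a M ν w (fun i j => M j (w i j)) i (fun l => kap M w (i l) * v l) f *
        (V0 * (K0 * C0)) := by
    have hval : ∀ (f : Core q → Fin q) (τ : Fin q ≃ Fin q), (∀ x, f x = τ x.1) →
        (∀ i j, M (τ i) (τ j) = M i j) → ∏ l, (a (τ (i l)) - v l) = C0 →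
        0 < term a M ν w (fun i j => M j (w i j)) i (fun l => kap M w (i l) * v l) f *
        (V0 * (K0 * C0)) := by
      intro f τ h1 h2 h3
      rw [term_iso ha1 hM τ h1 h2, h3]
      have := mul_pos (mul_pos (hpos1 τ) (hpos2 τ)) hsq
      refine lt_of_lt_of_eq this ?_
      ring
    refine Finset.sum_pos' ?_ ⟨Prod.fst, Finset.mem_univ _, ?_⟩
    · intro f _
      by_cases h0 : term a M ν w (fun i j => M j (w i j)) i (fun l => kap M w (i l) * v l) f = 0
      · rw [h0, zero_mul]
      · obtain ⟨τ, h1, h2, -⟩ := exists_iso_of_term_ne_zero hq (by simp) (fun k => (ha k).le) hνM h0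
        rcases hτ τ h2 with h3 | h3
        · rw [term_iso ha1 hM τ h1 h2, h3]
          simp
        · exact (hval f τ h1 h2 h3).le
    · exact hval _ (Equiv.refl _) (fun x => rfl) (fun _ _ => rfl) rfl
  rw [← Finset.sum_mul, hS] at hL
  have hne := left_ne_zero_of_mul hL.ne'
  obtain ⟨f, -, hf⟩ := Finset.exists_ne_zero_of_sum_ne_zero hne
  obtain ⟨τ, h1, h2, h3⟩ := exists_iso_of_term_ne_zero hq hκ hb hνM' hf
  refine ⟨τ, h2, h3, fun l hl => hf ?_⟩
  rw [term_iso hb1 hM τ h1 h2,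
    Finset.prod_eq_zero (f := fun l => b (τ (i l)) - v l) (Finset.mem_univ l) (by simp [hl])]
  simp

lemma FAgree.relabel {N : ℕ} {κ₁ κ₂ κ₃ : Type} [Fintype κ₁] [Fintype κ₂] [Fintype κ₃]
    {a : κ₁ → ℝ} {M : κ₁ → κ₁ → ℝ} {b : κ₂ → ℝ} {M' : κ₂ → κ₂ → ℝ} (h : FAgree N a M b M')
    (τ : κ₃ ≃ κ₂) {M'' : κ₃ → κ₃ → ℝ} (hτ : ∀ i j, M' (τ i) (τ j) = M'' i j) :
    FAgree N a M (b ∘ τ) M'' := by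
  intro V _ _ hV E hE p hp
  rw [h V hV E hE p hp]
  symm
  refine Fintype.sum_equiv (Equiv.arrowCongr (Equiv.refl V) τ) _ _ fun σ => ?_
  rw [ev_comp (W := M'') (M := M') (f := τ) (fun x y => (hτ x y).symm)]
  rfl

lemma FAgree.symm' {N : ℕ} {κ₁ κ₂ : Type} [Fintype κ₁] [Fintype κ₂]
    {a : κ₁ → ℝ} {M : κ₁ → κ₁ → ℝ} {b : κ₂ → ℝ} {M' : κ₂ → κ₂ → ℝ} (h : FAgree N a M b M') :
    FAgree N b M' a M := fun V _ _ hV E hE p hp => (h V hV E hE p hp).symm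

lemma finite_concl {q : ℕ} (hq : 2 ≤ q) {a : Fin q → ℝ} (ha : ∀ i, 0 < a i) (ha1 : ∑ i, a i = 1)
    {M : Fin q → Fin q → ℝ} (hM : ∀ x y, M x y = M y x)
    (htw : ∀ i j, i ≠ j → ∃ k, M i k ≠ M j k)
    {κ : Type} [Fintype κ] (hκ : Fintype.card κ ≤ q) {b : κ → ℝ} (hb : ∀ i, 0 ≤ b i)
    (hb1 : ∑ i, b i = 1) {M' : κ → κ → ℝ} (hM' : ∀ x y, M' x y = M' y x)
    (hF : FAgree (4 * q ^ 2 - q) a M b M') :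
    ∃ τ : Fin q ≃ κ, (∀ i j, M' (τ i) (τ j) = M i j) ∧ ∀ i, b (τ i) = a i := by
  have hq1 : 1 ≤ q := by omega
  obtain ⟨τ0, h0, hpos, -⟩ := lemX hq1 ha ha1 hM htw hκ hb hb1 hM' hF (Λ := Empty) (by simp)
    Empty.elim Empty.elim (fun l => l.elim) (fun τ _ => Or.inr (by simp))
  have hF' := hF.relabel τ0 h0
  have hc1 : ∑ i, (b ∘ τ0) i = 1 := by
    rw [← hb1]; exact τ0.sum_comp b
  set c : Fin q → ℝ := b ∘ τ0 with hc
  have hcpos : ∀ i, 0 < c i := hpos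
  -- values of `c` are values of `a`
  have hca : ∀ i, ∃ j, a j = c i := by
    intro i0
    set S : Finset ℝ := (Finset.univ.image a ∪ Finset.univ.image c).erase (c i0) with hS
    have hcard : S.card ≤ q ^ 2 := by
      rw [hS, Finset.card_erase_of_mem (by simp)]
      have h1 := Finset.card_union_le (Finset.univ.image a) (Finset.univ.image c)
      have h2 : (Finset.univ.image a).card ≤ q := Finset.card_image_le.trans (by simp)
      have h3 : (Finset.univ.image c).card ≤ q := Finset.card_image_le.trans (by simp)
      have : 2 * q ≤ q ^ 2 := by nlinarith
      omega
    obtain ⟨τ, h1, -, h3⟩ := lemX hq1 hcpos hc1 hM htw (κ := Fin q) (by simp) (fun i => (ha i).le)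
      ha1 hM hF'.symm' (Λ := S) (by simpa using hcard) (fun _ => i0) (fun l => l.1)
      (fun l => (Finset.ne_of_mem_erase l.2).symm) (by
        intro τ _
        by_cases h : c (τ i0) = c i0
        · right; rw [h]
        · left
          exact Finset.prod_eq_zero (i := ⟨c (τ i0), Finset.mem_erase.2 ⟨h, by simp⟩⟩)
            (Finset.mem_univ _) (by simp))
    refine ⟨τ i0, ?_⟩
    by_contra h
    exact h3 ⟨a (τ i0), Finset.mem_erase.2 ⟨h, by simp⟩⟩ rfl
  let S : Fin q → Finset ℝ := fun i => (Finset.univ.image a).erase (a i)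
  have hcard : Fintype.card ((i : Fin q) × S i) ≤ q ^ 2 := by
    rw [Fintype.card_sigma]
    calc ∑ i, Fintype.card (S i) ≤ ∑ i : Fin q, q := by
          refine Finset.sum_le_sum fun i _ => ?_
          rw [Fintype.card_coe]
          exact (Finset.card_erase_le).trans (Finset.card_image_le.trans (by simp))
      _ = q ^ 2 := by simp [sq]
  obtain ⟨τ, h1, -, h3⟩ := lemX hq1 ha ha1 hM htw (κ := Fin q) (by simp) (fun i => (hcpos i).le)
      hc1 hM hF' (Λ := (i : Fin q) × S i) hcard (fun l => l.1) (fun l => l.2.1)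
      (fun l => (Finset.ne_of_mem_erase l.2.2).symm) (by
        intro τ _
        by_cases h : ∀ i, a (τ i) = a i
        · right; simp only [h]
        · left
          push Not at h
          obtain ⟨i, hi⟩ := h
          exact Finset.prod_eq_zero (i := ⟨i, a (τ i), Finset.mem_erase.2 ⟨hi, by simp⟩⟩)
            (Finset.mem_univ _) (by simp))
  refine ⟨τ.trans τ0, fun i j => ?_, fun i => ?_⟩
  · simp only [Equiv.trans_apply, h0, h1]
  · change c (τ i) = a i
    by_contra h
    obtain ⟨j, hj⟩ := hca (τ i)
    exact h3 ⟨i, c (τ i), Finset.mem_erase.2 ⟨h, by simp [← hj]⟩⟩ rfl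

lemma integrable_bdd {Ω : Type*} [MeasurableSpace Ω] {μ : Measure Ω} [IsFiniteMeasure μ]
    {F : Ω → ℝ} (hF : Measurable F) {C : ℝ} (hC : ∀ x, |F x| ≤ C) : Integrable F μ :=
  Integrable.of_bound (C := C) hF.aestronglyMeasurable (Filter.Eventually.of_forall hC)

lemma measurable_elim {A B : Type} (f : A → I01) :
    Measurable fun g : B → I01 => (Sum.elim f g : A ⊕ B → I01) := by
  rw [measurable_pi_iff]
  rintro (a | b)
  · exact measurable_const
  · exact measurable_pi_apply b

lemma integral_sum_arrow {A B : Type} [Fintype A] [Fintype B] {F : (A ⊕ B → I01) → ℝ}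
    (hF : Measurable F) {C : ℝ} (hC : ∀ x, |F x| ≤ C) :
    ∫ x, F x = ∫ f : A → I01, ∫ g : B → I01, F (Sum.elim f g) := by
  have hmp := (volume_measurePreserving_sumPiEquivProdPi_symm (fun _ : A ⊕ B => I01))
  rw [← hmp.integral_comp (MeasurableEquiv.measurableEmbedding _), Measure.volume_eq_prod, integral_prod]
  · refine integral_congr_ae (Filter.Eventually.of_forall fun f => ?_)
    refine integral_congr_ae (Filter.Eventually.of_forall fun g => ?_)
    simp only
    congr 1
  · exact integrable_bdd (hF.comp (MeasurableEquiv.measurable _)) (fun _ => hC _)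

def gg (U : GKernel) (x w : I01) : ℝ := ∫ z, U.toFun x z * U.toFun z w
def DD (U : GKernel) (x y : I01) : ℝ := ∫ w, (gg U x w - gg U y w) ^ 2

abbrev VV (k : ℕ) : Type := Fin k ⊕ (Tri k ⊕ (Tri k ⊕ Tri k))

def PP {k : ℕ} (r : Tri k) : MvPolynomial (Sym2 (VV k)) ℝ :=
  (MvPolynomial.X s(Sum.inl r.lo, Sum.inr (Sum.inr (Sum.inl r))) -
    MvPolynomial.X s(Sum.inl r.hi, Sum.inr (Sum.inr (Sum.inl r)))) *
  MvPolynomial.X s(Sum.inr (Sum.inr (Sum.inl r)), Sum.inr (Sum.inl r)) *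
  (MvPolynomial.X s(Sum.inr (Sum.inr (Sum.inr r)), Sum.inr (Sum.inl r)) *
  (MvPolynomial.X s(Sum.inl r.lo, Sum.inr (Sum.inr (Sum.inr r))) -
    MvPolynomial.X s(Sum.inl r.hi, Sum.inr (Sum.inr (Sum.inr r)))))

def PE {k : ℕ} (r : Tri k) : Set (Sym2 (VV k)) :=
  (({s(Sum.inl r.lo, Sum.inr (Sum.inr (Sum.inl r)))} ∪
    {s(Sum.inl r.hi, Sum.inr (Sum.inr (Sum.inl r)))}) ∪
  {s(Sum.inr (Sum.inr (Sum.inl r)), Sum.inr (Sum.inl r))}) ∪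
  ({s(Sum.inr (Sum.inr (Sum.inr r)), Sum.inr (Sum.inl r))} ∪
  ({s(Sum.inl r.lo, Sum.inr (Sum.inr (Sum.inr r)))} ∪
    {s(Sum.inl r.hi, Sum.inr (Sum.inr (Sum.inr r)))}))

lemma MA_PP {k : ℕ} (r : Tri k) : MA (PE r) (PP r) := by
  unfold PE PP
  refine MA.mul (MA.mul (MA.sub (MA.X _) (MA.X _)) (MA.X _) ?_)
    (MA.mul (MA.X _) (MA.sub (MA.X _) (MA.X _)) ?_) ?_ <;>
  simp [Set.disjoint_left]

lemma MA_prodPP (k : ℕ) : MA (⋃ r ∈ (Finset.univ : Finset (Tri k)), PE r) (∏ r : Tri k, PP r) := by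
  refine MA.prod MA_PP fun r r' h => ?_
  rw [Set.disjoint_left]
  intro e he he'
  apply h
  simp only [PE, Set.mem_union, Set.mem_singleton_iff] at he he'
  rcases he with ((he | he) | he) | (he | (he | he)) <;> subst he <;> simp at he' <;> tauto

lemma nondiag_PP (k : ℕ) : ∀ e ∈ (⋃ r ∈ (Finset.univ : Finset (Tri k)), PE r), ¬ e.IsDiag := by
  intro e he
  simp only [Set.mem_iUnion] at he
  obtain ⟨r, -, he⟩ := he
  simp only [PE, Set.mem_union, Set.mem_singleton_iff] at he
  rcases he with ((he | he) | he) | (he | (he | he)) <;> subst he <;> simp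

lemma bounded_eval (U : GKernel) {V : Type} [Fintype V] (p : MvPolynomial (Sym2 V) ℝ) :
    ∃ C, ∀ x : V → I01, |MvPolynomial.eval (ev U.toFun x) p| ≤ C := by
  obtain ⟨C, hC0, hC⟩ := bounded_ev U
  refine ⟨∑ d ∈ p.support, |MvPolynomial.coeff d p| * ∏ i ∈ d.support, C ^ d i, fun x => ?_⟩
  rw [MvPolynomial.eval_eq]
  refine (Finset.abs_sum_le_sum_abs _ _).trans (Finset.sum_le_sum fun d _ => ?_)
  rw [abs_mul, Finset.abs_prod]
  refine mul_le_mul_of_nonneg_left ?_ (abs_nonneg _)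
  refine Finset.prod_le_prod (fun _ _ => abs_nonneg _) fun e _ => ?_
  rw [abs_pow]
  exact pow_le_pow_left₀ (abs_nonneg _) (hC V e x) _

lemma integrable_row (U : GKernel) (x w : I01) : Integrable fun z => U.toFun x z * U.toFun z w := by
  obtain ⟨C, hC⟩ := U.bounded'
  refine integrable_bdd (C := C * C) ?_ ?_
  · exact (U.measurable'.comp (measurable_const.prodMk measurable_id)).mul
      (U.measurable'.comp (measurable_id.prodMk measurable_const))
  · intro z
    rw [abs_mul]
    exact mul_le_mul (hC _ _) (hC _ _) (abs_nonneg _) ((abs_nonneg _).trans (hC x w))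

lemma integral_PP (U : GKernel) (k : ℕ) :
    ∫ x : VV k → I01, MvPolynomial.eval (ev U.toFun x) (∏ r : Tri k, PP r) =
      ∫ x : Fin k → I01, ∏ r : Tri k, DD U (x r.lo) (x r.hi) := by
  obtain ⟨C, hC⟩ := bounded_eval U (∏ r : Tri k, PP r)
  have hm := measurable_eval U (∏ r : Tri k, PP r)
  rw [integral_sum_arrow hm hC]
  congr 1
  funext x
  have hm1 := hm.comp (measurable_elim x)
  simp only [Function.comp_def] at hm1
  rw [integral_sum_arrow hm1 (fun _ => hC _)]
  have h1 : ∀ t : Tri k → I01, ∫ g : Tri k ⊕ Tri k → I01,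
      MvPolynomial.eval (ev U.toFun (Sum.elim x (Sum.elim t g))) (∏ r : Tri k, PP r) =
      ∏ r : Tri k, (gg U (x r.lo) (t r) - gg U (x r.hi) (t r)) ^ 2 := by
    intro t
    have hm2 := hm1.comp (measurable_elim t)
    simp only [Function.comp_def] at hm2
    rw [integral_sum_arrow hm2 (fun _ => hC _)]
    have h2 : ∀ s u : Tri k → I01, MvPolynomial.eval
        (ev U.toFun (Sum.elim x (Sum.elim t (Sum.elim s u)))) (∏ r : Tri k, PP r) =
        (∏ r : Tri k, (U.toFun (x r.lo) (s r) * U.toFun (s r) (t r) -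
          U.toFun (x r.hi) (s r) * U.toFun (s r) (t r))) *
        ∏ r : Tri k, (U.toFun (x r.lo) (u r) * U.toFun (u r) (t r) -
          U.toFun (x r.hi) (u r) * U.toFun (u r) (t r)) := by
      intro s u
      rw [map_prod, ← Finset.prod_mul_distrib]
      refine Finset.prod_congr rfl fun r _ => ?_
      simp only [PP, map_mul, map_sub, MvPolynomial.eval_X, U.ev_mk', Sum.elim_inl, Sum.elim_inr]
      ring
    simp only [h2, integral_const_mul, integral_mul_const]
    rw [integral_fintype_prod_volume_eq_prod (fun (r : Tri k) (z : I01) =>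
      (U.toFun (x r.lo) z * U.toFun z (t r) - U.toFun (x r.hi) z * U.toFun z (t r))),
      ← Finset.prod_mul_distrib]
    refine Finset.prod_congr rfl fun r _ => ?_
    rw [integral_sub (integrable_row _ _ _) (integrable_row _ _ _), sq]
    rfl
  simp only [h1]
  rw [integral_fintype_prod_volume_eq_prod (fun (r : Tri k) (z : I01) =>
    (gg U (x r.lo) z - gg U (x r.hi) z) ^ 2)]
  rfl

lemma DD_nonneg (U : GKernel) (x y : I01) : 0 ≤ DD U x y := integral_nonneg fun _ => sq_nonneg _

lemma measurable_gg (U : GKernel) : Measurable (Function.uncurry (gg U)) := by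
  have h : StronglyMeasurable (Function.uncurry fun (p : I01 × I01) z =>
      U.toFun p.1 z * U.toFun z p.2) := by
    refine Measurable.stronglyMeasurable ?_
    exact (U.measurable'.comp ((measurable_fst.comp measurable_fst).prodMk measurable_snd)).mul
      (U.measurable'.comp (measurable_snd.prodMk (measurable_snd.comp measurable_fst)))
  exact (h.integral_prod_right (ν := volume)).measurable

lemma bounded_gg (U : GKernel) : ∃ C, ∀ x y, |gg U x y| ≤ C := by
  obtain ⟨C, hC⟩ := U.bounded'
  refine ⟨C * C, fun x y => ?_⟩
  have := norm_integral_le_of_norm_le_const (μ := (volume : Measure I01)) (C := C * C)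
    (f := fun z => U.toFun x z * U.toFun z y) (Filter.Eventually.of_forall fun z => by
      rw [Real.norm_eq_abs, abs_mul]
      exact mul_le_mul (hC _ _) (hC _ _) (abs_nonneg _) ((abs_nonneg _).trans (hC x y)))
  simpa [gg] using this

lemma measurable_DD (U : GKernel) : Measurable (Function.uncurry (DD U)) := by
  have h : StronglyMeasurable (Function.uncurry fun (p : I01 × I01) w =>
      (gg U p.1 w - gg U p.2 w) ^ 2) := by
    refine Measurable.stronglyMeasurable ?_
    exact (((measurable_gg U).comp ((measurable_fst.comp measurable_fst).prodMk measurable_snd)).sub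
      ((measurable_gg U).comp ((measurable_snd.comp measurable_fst).prodMk
        measurable_snd))).pow_const 2
  exact (h.integral_prod_right (ν := volume)).measurable

lemma bounded_DD (U : GKernel) : ∃ C, ∀ x y, |DD U x y| ≤ C := by
  obtain ⟨C, hC⟩ := bounded_gg U
  refine ⟨(C + C) ^ 2, fun x y => ?_⟩
  have := norm_integral_le_of_norm_le_const (μ := (volume : Measure I01)) (C := (C + C) ^ 2)
    (f := fun w => (gg U x w - gg U y w) ^ 2) (Filter.Eventually.of_forall fun z => by
      rw [Real.norm_eq_abs, abs_pow]
      exact pow_le_pow_left₀ (abs_nonneg _)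
        ((abs_sub _ _).trans (add_le_add (hC _ _) (hC _ _))) _)
  simpa [DD] using this

lemma DD_eq_zero (U : GKernel) {x y : I01} (h : DD U x y = 0) : ∀ᵐ w, gg U x w = gg U y w := by
  obtain ⟨C, hC⟩ := bounded_gg U
  have hm : ∀ x, Measurable (gg U x) := fun x => (measurable_gg U).of_uncurry_left
  have hi : Integrable fun w => (gg U x w - gg U y w) ^ 2 := by
    refine integrable_bdd (C := (C + C) ^ 2) (((hm x).sub (hm y)).pow_const 2) fun w => ?_
    rw [abs_pow]
    exact pow_le_pow_left₀ (abs_nonneg _) ((abs_sub _ _).trans (add_le_add (hC _ _) (hC _ _))) _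
  have := (integral_eq_zero_iff_of_nonneg (fun w => sq_nonneg _) hi).1 h
  filter_upwards [this] with w hw
  have : (gg U x w - gg U y w) ^ 2 = 0 := hw
  exact sub_eq_zero.1 (pow_eq_zero_iff (two_ne_zero) |>.1 this)

lemma ae_sep {U U' : GKernel} {q : ℕ} (hq : 2 ≤ q)
    (hagree : ∀ n : ℕ, n ≤ 4 * q ^ 2 - q → ∀ H : SimpleGraph (Fin n),
      homDensity H U' = homDensity H U)
    (π : I01 → Fin q) (M : Fin q → Fin q → ℝ) (hU : ∀ x y, U.toFun x y = M (π x) (π y)) :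
    ∀ᵐ x : Fin (q + 1) → I01, ∃ i j, i ≠ j ∧ DD U' (x i) (x j) = 0 := by
  have hcard : Fintype.card (VV (q + 1)) ≤ 4 * q ^ 2 - q := by
    have h1 := card_Tri (q + 1)
    simp only [VV, Fintype.card_sum, Fintype.card_fin]
    have h2 : q + 1 - 1 = q := by omega
    rw [h2] at h1
    have h3 : 2 * (4 * q ^ 2) ≥ 2 * q + 2 * (q + 1) + 3 * ((q + 1) * q) := by nlinarith
    omega
  have key := key_agree hagree hcard (nondiag_PP (q + 1)) (MA_prodPP (q + 1))
  rw [integral_PP, integral_PP] at key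
  have hU0 : ∀ x : Fin (q + 1) → I01, ∏ r : Tri (q + 1), DD U (x r.lo) (x r.hi) = 0 := by
    intro x
    obtain ⟨i, j, hij, hp⟩ := Fintype.exists_ne_map_eq_of_card_lt (fun i => π (x i)) (by simp)
    have hD : ∀ i j, π (x i) = π (x j) → DD U (x i) (x j) = 0 := by
      intro i j h
      simp [DD, gg, hU, h]
    rcases lt_or_gt_of_ne hij with h | h
    · exact Finset.prod_eq_zero (i := (⟨j, ⟨i.1, h⟩⟩ : Tri (q + 1))) (Finset.mem_univ _) (hD _ _ hp)
    · exact Finset.prod_eq_zero (i := (⟨i, ⟨j.1, h⟩⟩ : Tri (q + 1))) (Finset.mem_univ _)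
        (hD _ _ hp.symm)
  simp only [hU0, integral_zero] at key
  obtain ⟨C, hC⟩ := bounded_DD U'
  have hi : Integrable fun x : Fin (q + 1) → I01 => ∏ r : Tri (q + 1), DD U' (x r.lo) (x r.hi) := by
    refine integrable_bdd (C := ∏ _r : Tri (q + 1), C) ?_ ?_
    · refine Finset.measurable_prod _ fun r _ => ?_
      have h : Measurable fun x : Fin (q + 1) → I01 => (x r.lo, x r.hi) :=
        (measurable_pi_apply r.lo).prodMk (measurable_pi_apply r.hi)
      exact (measurable_DD U').comp h
    · intro x
      rw [Finset.abs_prod]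
      exact Finset.prod_le_prod (fun _ _ => abs_nonneg _) fun e _ => hC _ _
  have := (integral_eq_zero_iff_of_nonneg
    (fun x => Finset.prod_nonneg fun r _ => DD_nonneg _ _ _) hi).1 key
  filter_upwards [this] with x hx
  obtain ⟨r, -, hr⟩ := Finset.prod_eq_zero_iff.1 hx
  exact ⟨r.lo, r.hi, r.lt.ne, hr⟩

lemma DD_symm (U : GKernel) (x y : I01) : DD U x y = DD U y x := by
  unfold DD
  congr 1
  funext w
  ring

lemma exists_points {U : GKernel} {q : ℕ}
    (h : ∀ᵐ x : Fin (q + 1) → I01, ∃ i j, i ≠ j ∧ DD U (x i) (x j) = 0) :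
    ∃ k ≤ q, ∃ x : Fin k → I01, ∀ᵐ y, ∃ i, DD U y (x i) = 0 := by
  have hex : ∃ k, ∀ᵐ x : Fin (k + 1) → I01, ∃ i j, i ≠ j ∧ DD U (x i) (x j) = 0 := ⟨q, h⟩
  set k := Nat.find hex with hk
  have hk1 : ∀ᵐ x : Fin (k + 1) → I01, ∃ i j, i ≠ j ∧ DD U (x i) (x j) = 0 := Nat.find_spec hex
  have hk2 : ¬ ∀ᵐ x : Fin k → I01, ∃ i j, i ≠ j ∧ DD U (x i) (x j) = 0 := by
    rcases hk0 : k with _ | m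
    · intro h0
      obtain ⟨x, i, -⟩ := h0.exists
      exact i.elim0
    · exact Nat.find_min hex (by omega)
  refine ⟨k, Nat.find_min' hex h, ?_⟩
  have hmp := (volume_preserving_piFinSuccAbove (fun _ : Fin (k + 1) => I01) 0).symm
  have h1 := hmp.quasiMeasurePreserving.ae hk1
  rw [Measure.volume_eq_prod] at h1
  have h2 := (Measure.measurePreserving_swap (μ := (volume : Measure (Fin k → I01)))
    (ν := (volume : Measure I01))).quasiMeasurePreserving.ae h1
  have h3 := Measure.ae_ae_of_ae_prod h2
  obtain ⟨x, hx1, hx2⟩ := ((Filter.not_eventually.1 hk2).and_eventually h3).exists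
  refine ⟨x, ?_⟩
  push Not at hx1
  filter_upwards [hx2] with y hy
  obtain ⟨i, j, hij, hD⟩ := hy
  induction i using Fin.cases with
  | zero =>
    induction j using Fin.cases with
    | zero => exact absurd rfl hij
    | succ j =>
      refine ⟨j, ?_⟩
      simpa [MeasurableEquiv.piFinSuccAbove] using hD
  | succ i =>
    induction j using Fin.cases with
    | zero =>
      refine ⟨i, ?_⟩
      rw [DD_symm]
      simpa [MeasurableEquiv.piFinSuccAbove] using hD
    | succ j =>
      exfalso
      refine hx1 i j (fun h => hij (by rw [h])) ?_
      simpa [MeasurableEquiv.piFinSuccAbove] using hD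

lemma exists_selection {k : ℕ} {E : Fin k → Set I01} (hE : ∀ i, MeasurableSet (E i))
    (h : ∀ᵐ y, ∃ i, y ∈ E i) : ∃ π : I01 → Fin k, Measurable π ∧ ∀ᵐ y, y ∈ E (π y) := by
  obtain ⟨_, i0, _⟩ := h.exists
  have hk : 0 < k := lt_of_le_of_lt (Nat.zero_le _) i0.2
  let p : I01 → ℕ → Prop := fun y n => (∃ h : n < k, y ∈ E ⟨n, h⟩) ∨ n = k - 1
  have hp : ∀ y, ∃ n, p y n := fun y => ⟨k - 1, Or.inr rfl⟩
  have hlt : ∀ y, Nat.find (hp y) < k := fun y =>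
    lt_of_le_of_lt (Nat.find_min' (hp y) (Or.inr rfl)) (by omega)
  have hm : Measurable fun y => Nat.find (hp y) := by
    refine measurable_find hp fun n => ?_
    by_cases hn : n < k
    · by_cases hn' : n = k - 1
      · simp [p, hn']
      · simpa [p, hn', hn] using hE ⟨n, hn⟩
    · by_cases hn' : n = k - 1
      · simp [p, hn']
      · simp [p, hn', hn]
  refine ⟨fun y => ⟨Nat.find (hp y), hlt y⟩, ?_, ?_⟩
  · refine measurable_to_countable' fun i => ?_
    have : (fun y => (⟨Nat.find (hp y), hlt y⟩ : Fin k)) ⁻¹' {i} =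
        (fun y => Nat.find (hp y)) ⁻¹' {i.1} := by
      ext y; simp [Fin.ext_iff]
    rw [this]
    exact hm (measurableSet_singleton _)
  · filter_upwards [h] with y hy
    obtain ⟨i, hi⟩ := hy
    rcases Nat.find_spec (hp y) with ⟨h1, h2⟩ | h1
    · exact h2
    · have h3 : Nat.find (hp y) ≤ i.1 := Nat.find_min' (hp y) (Or.inl ⟨i.2, hi⟩)
      have h4 : (⟨Nat.find (hp y), hlt y⟩ : Fin k) = i := by
        ext; simp only; have := i.2; omega
      rw [h4]; exact hi

lemma exists_classes {U : GKernel} {q : ℕ}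
    (h : ∀ᵐ x : Fin (q + 1) → I01, ∃ i j, i ≠ j ∧ DD U (x i) (x j) = 0) :
    ∃ k ≤ q, ∃ π : I01 → Fin k, Measurable π ∧ ∃ G : Fin k → I01 → ℝ,
      ∀ᵐ y, ∀ᵐ w, gg U y w = G (π y) w := by
  obtain ⟨k, hk, x, hx⟩ := exists_points h
  obtain ⟨π, hπ, hπ'⟩ := exists_selection (E := fun i => {y | DD U y (x i) = 0}) (fun i => by
    have : Measurable fun y => DD U y (x i) :=
      (measurable_DD U).comp (measurable_id.prodMk measurable_const)
    exact this (measurableSet_singleton 0)) hx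
  refine ⟨k, hk, π, hπ, fun i => gg U (x i), ?_⟩
  filter_upwards [hπ'] with y hy
  exact DD_eq_zero U hy

lemma measurable_Tphi (U : GKernel) {φ : I01 → ℝ} (hφ : Measurable φ) :
    Measurable fun z => ∫ y, φ y * U.toFun y z := by
  have h : StronglyMeasurable (Function.uncurry fun z y => φ y * U.toFun y z) := by
    refine Measurable.stronglyMeasurable ?_
    exact (hφ.comp measurable_snd).mul (U.measurable'.comp (measurable_snd.prodMk measurable_fst))
  exact (h.integral_prod_right (ν := volume)).measurable

lemma bounded_Tphi (U : GKernel) {φ : I01 → ℝ} {C : ℝ} (hC : ∀ x, |φ x| ≤ C) :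
    ∃ C', ∀ z, |∫ y, φ y * U.toFun y z| ≤ C' := by
  obtain ⟨K, hK⟩ := U.bounded'
  refine ⟨C * K, fun z => ?_⟩
  have := norm_integral_le_of_norm_le_const (μ := (volume : Measure I01)) (C := C * K)
    (f := fun y => φ y * U.toFun y z) (Filter.Eventually.of_forall fun y => by
      rw [Real.norm_eq_abs, abs_mul]
      exact mul_le_mul (hC _) (hK _ _) (abs_nonneg _) ((abs_nonneg _).trans (hC z)))
  simpa using this

lemma Tphi_zero (U : GKernel) {B : Set I01} {G : I01 → ℝ}
    (hG : ∀ᵐ y, y ∈ B → ∀ᵐ w, gg U y w = G w) {φ : I01 → ℝ} (hφ : Measurable φ) {C : ℝ}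
    (hC : ∀ x, |φ x| ≤ C) (hB : ∀ y, y ∉ B → φ y = 0) (h0 : ∫ y, φ y = 0) :
    ∀ᵐ z, ∫ y, φ y * U.toFun y z = 0 := by
  obtain ⟨K, hK⟩ := U.bounded'
  obtain ⟨C', hC'⟩ := bounded_Tphi U hC
  have hm := measurable_Tphi U hφ
  set f : I01 → ℝ := fun z => ∫ y, φ y * U.toFun y z with hf
  have hC0 : 0 ≤ C := (abs_nonneg _).trans (hC 0)
  have hK0 : 0 ≤ K := (abs_nonneg _).trans (hK 0 0)
  have hC'0 : 0 ≤ C' := (abs_nonneg _).trans (hC' 0)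
  have h1 : ∀ y, ∫ z, U.toFun y z * f z = ∫ w, φ w * gg U y w := by
    intro y
    have e1 : ∀ z, U.toFun y z * f z = ∫ w, U.toFun y z * (φ w * U.toFun w z) := fun z => by
      rw [integral_const_mul]
    have e2 : ∀ w, φ w * gg U y w = ∫ z, U.toFun y z * (φ w * U.toFun w z) := fun w => by
      unfold gg
      rw [← integral_const_mul]
      congr 1
      funext z
      rw [U.symm' z w]; ring
    simp only [e1, e2]
    refine integral_integral_swap ?_
    refine integrable_bdd (C := K * (C * K)) ?_ ?_
    · exact (U.measurable'.comp (measurable_const.prodMk measurable_fst)).mul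
        ((hφ.comp measurable_snd).mul (U.measurable'.comp (measurable_snd.prodMk measurable_fst)))
    · rintro ⟨z, w⟩
      simp only [Function.uncurry, abs_mul]
      gcongr
      · exact hK _ _
      · exact hC _
      · exact hK _ _
  have h2 : ∫ z, f z ^ 2 = ∫ y, φ y * ∫ z, U.toFun y z * f z := by
    have e1 : ∀ z, f z ^ 2 = ∫ y, φ y * (U.toFun y z * f z) := fun z => by
      have : ∀ y, φ y * (U.toFun y z * f z) = (φ y * U.toFun y z) * f z := fun y => by ring
      simp only [this]
      rw [integral_mul_const, sq]
    simp only [e1, ← integral_const_mul]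
    refine integral_integral_swap ?_
    refine integrable_bdd (C := C * (K * C')) ?_ ?_
    · exact (hφ.comp measurable_snd).mul ((U.measurable'.comp
        (measurable_snd.prodMk measurable_fst)).mul (hm.comp measurable_fst))
    · rintro ⟨z, w⟩
      simp only [Function.uncurry, abs_mul]
      gcongr
      · exact hC _
      · exact hK _ _
      · exact hC' _
  have h3 : ∫ y, φ y * ∫ z, U.toFun y z * f z = ∫ y, φ y * ∫ w, φ w * G w := by
    refine integral_congr_ae ?_
    filter_upwards [hG] with y hy
    by_cases hyB : y ∈ B
    · rw [h1]
      congr 1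
      refine integral_congr_ae ?_
      filter_upwards [hy hyB] with w hw
      rw [hw]
    · rw [hB y hyB]; simp
  rw [integral_mul_const, h0, zero_mul] at h3
  rw [h3] at h2
  have hi : Integrable fun z => f z ^ 2 := by
    refine integrable_bdd (C := C' ^ 2) (hm.pow_const 2) fun z => ?_
    rw [abs_pow]
    exact pow_le_pow_left₀ (abs_nonneg _) (hC' z) _
  have := (integral_eq_zero_iff_of_nonneg (fun w => sq_nonneg _) hi).1 h2
  filter_upwards [this] with z hz
  have : f z ^ 2 = 0 := hz
  exact (pow_eq_zero_iff two_ne_zero).1 this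

def FF (U : GKernel) (S T : Set I01) : ℝ := ∫ z in T, ∫ y in S, U.toFun y z

lemma integrable_U (U : GKernel) (μ : Measure (I01 × I01)) [IsFiniteMeasure μ] :
    Integrable (Function.uncurry U.toFun) μ := by
  obtain ⟨K, hK⟩ := U.bounded'
  exact integrable_bdd U.measurable' (fun _ => hK _ _)

lemma FF_symm (U : GKernel) (S T : Set I01) : FF U S T = FF U T S := by
  unfold FF
  rw [integral_integral_swap (f := fun z y => U.toFun y z)]
  · congr 1
    funext y
    congr 1
    funext z
    exact U.symm' _ _
  · exact (integrable_U U _).swap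

lemma FF_left (U : GKernel) {B S : Set I01} {G : I01 → ℝ}
    (hG : ∀ᵐ y, y ∈ B → ∀ᵐ w, gg U y w = G w) (hB : MeasurableSet B) (hS : MeasurableSet S)
    (hSB : S ⊆ B) (T : Set I01) :
    (volume : Measure I01).real B * FF U S T = (volume : Measure I01).real S * FF U B T := by
  set μ : Measure I01 := volume
  have hi : ∀ A : Set I01, MeasurableSet A → ∀ z,
      Integrable fun y => A.indicator (fun _ => (1 : ℝ)) y * U.toFun y z := by
    obtain ⟨K, hK⟩ := U.bounded'
    intro A hA z
    refine integrable_bdd (C := 1 * K) ((measurable_const.indicator hA).mul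
      (U.measurable'.comp (measurable_id.prodMk measurable_const))) fun y => ?_
    rw [abs_mul]
    gcongr
    · by_cases h : y ∈ A <;> simp [h]
    · exact hK _ _
  have he : ∀ A : Set I01, MeasurableSet A → ∀ z,
      ∫ y, A.indicator (fun _ => (1 : ℝ)) y * U.toFun y z = ∫ y in A, U.toFun y z := by
    intro A hA z
    rw [← integral_indicator hA]
    congr 1
    funext y
    by_cases h : y ∈ A <;> simp [h]
  have hii : ∀ A : Set I01, MeasurableSet A →
      Integrable (A.indicator fun _ => (1 : ℝ)) (volume : Measure I01) :=
    fun A hA => (integrable_const _).indicator hA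
  have key := Tphi_zero U hG (φ := fun y => μ.real B * S.indicator (fun _ => 1) y -
      μ.real S * B.indicator (fun _ => 1) y) (C := μ.real B + μ.real S)
    (((measurable_const.indicator hS).const_mul _).sub ((measurable_const.indicator hB).const_mul _))
    (by
      intro y
      have h1 := measureReal_nonneg (μ := μ) (s := B)
      have h2 := measureReal_nonneg (μ := μ) (s := S)
      by_cases hyS : y ∈ S <;> by_cases hyB : y ∈ B <;> simp [hyS, hyB, abs_le] <;>
        (try constructor) <;> linarith)
    (by
      intro y hy
      have : y ∉ S := fun h => hy (hSB h)
      simp [hy, this])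
    (by
      rw [integral_sub ((hii S hS).const_mul _) ((hii B hB).const_mul _), integral_const_mul,
        integral_const_mul, integral_indicator_const _ hS, integral_indicator_const _ hB]
      simp [μ, mul_comm])
  have key2 : ∀ᵐ z, μ.real B * ∫ y in S, U.toFun y z = μ.real S * ∫ y in B, U.toFun y z := by
    filter_upwards [key] with z hz
    simp only [sub_mul, mul_assoc] at hz
    rw [integral_sub ((hi S hS z).const_mul _) ((hi B hB z).const_mul _), integral_const_mul,
        integral_const_mul, he S hS, he B hB] at hz
    linarith
  unfold FF
  rw [← integral_const_mul, ← integral_const_mul]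
  exact integral_congr_ae (ae_restrict_of_ae key2)

lemma ae_const_of_rect {μ ν : Measure I01} [IsFiniteMeasure μ] [IsFiniteMeasure ν]
    {f : I01 × I01 → ℝ} (hf : Integrable f (μ.prod ν)) (c : ℝ)
    (h : ∀ S T, MeasurableSet S → MeasurableSet T →
      ∫ p in S ×ˢ T, f p ∂(μ.prod ν) = c * (μ.real S * ν.real T)) :
    ∀ᵐ p ∂(μ.prod ν), f p = c := by
  refine hf.ae_eq_of_forall_setIntegral_eq _ _ (integrable_const c) ?_
  intro s hs _
  have hc : ∀ s, ∫ _p in s, c ∂(μ.prod ν) = (μ.prod ν).real s * c := fun s => by simp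
  induction s, hs using MeasurableSpace.induction_on_inter generateFrom_prod.symm isPiSystem_prod with
  | empty => simp
  | basic t ht =>
    obtain ⟨S, hS, T, hT, rfl⟩ := ht
    rw [h S T hS hT, hc, measureReal_prod_prod, mul_comm]
  | compl t ht ih =>
    have h1 := integral_add_compl ht hf
    have h2 := integral_add_compl ht (integrable_const (μ := μ.prod ν) c)
    have h3 := h Set.univ Set.univ MeasurableSet.univ MeasurableSet.univ
    have h4 := hc Set.univ
    rw [← Set.univ_prod_univ, measureReal_prod_prod] at h4
    simp only [Set.univ_prod_univ, Measure.restrict_univ] at h3 h4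
    have := ih (measure_lt_top _ _)
    linarith
  | iUnion f' hd hm ih =>
    rw [integral_iUnion hm hd hf.integrableOn, integral_iUnion hm hd (integrable_const c).integrableOn]
    congr 1
    funext i
    exact ih i (measure_lt_top _ _)

lemma ae_step (U : GKernel) {k : ℕ} {π : I01 → Fin k} (hπ : Measurable π) {G : Fin k → I01 → ℝ}
    (hG : ∀ᵐ y, ∀ᵐ w, gg U y w = G (π y) w) :
    ∃ M : Fin k → Fin k → ℝ, (∀ i j, M i j = M j i) ∧
      ∀ᵐ p ∂((volume : Measure I01).prod (volume : Measure I01)),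
        U.toFun p.1 p.2 = M (π p.1) (π p.2) := by
  set B : Fin k → Set I01 := fun i => π ⁻¹' {i} with hBdef
  have hB : ∀ i, MeasurableSet (B i) := fun i => hπ (measurableSet_singleton i)
  have hGB : ∀ i, ∀ᵐ y, y ∈ B i → ∀ᵐ w, gg U y w = G i w := by
    intro i
    filter_upwards [hG] with y hy hyB
    have : π y = i := hyB
    rwa [this] at hy
  set m : Set I01 → ℝ := fun S => (volume : Measure I01).real S with hm
  set M : Fin k → Fin k → ℝ := fun i j => FF U (B i) (B j) / (m (B i) * m (B j)) with hMdef
  have hMs : ∀ i j, M i j = M j i := by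
    intro i j
    simp only [hMdef]
    rw [FF_symm, mul_comm (m (B i))]
  have hzero : ∀ S T : Set I01, m T = 0 → FF U S T = 0 := by
    intro S T hT
    unfold FF
    refine setIntegral_measure_zero _ ?_
    simpa [hm, measureReal_def, ENNReal.toReal_eq_zero_iff] using hT
  have hmono : ∀ S i, S ⊆ B i → m (B i) = 0 → m S = 0 := by
    intro S i hS h0
    exact le_antisymm (h0 ▸ measureReal_mono hS) measureReal_nonneg
  have hloc : ∀ i j S T, MeasurableSet S → MeasurableSet T → S ⊆ B i → T ⊆ B j →
      FF U T S = M i j * (m S * m T) := by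
    intro i j S T hS hT hSB hTB
    by_cases hi0 : m (B i) = 0
    · have := hmono S i hSB hi0
      rw [hzero _ _ this, this]; ring
    by_cases hj0 : m (B j) = 0
    · have := hmono T j hTB hj0
      rw [FF_symm, hzero _ _ this, this]; ring
    have h1 := FF_left U (hGB j) (hB j) hT hTB S
    have h2 := FF_left U (hGB i) (hB i) hS hSB (B j)
    rw [FF_symm U (B j) S] at h1
    simp only [hMdef]
    field_simp
    simp only [hm] at *
    linear_combination (volume : Measure I01).real (B i) * h1 + (volume : Measure I01).real T * h2
  have hae : ∀ i j, ∀ᵐ p ∂((volume : Measure I01).prod (volume : Measure I01)),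
      p ∈ B i ×ˢ B j → U.toFun p.1 p.2 = M i j := by
    intro i j
    rw [← ae_restrict_iff' ((hB i).prod (hB j)), ← Measure.prod_restrict]
    refine ae_const_of_rect (f := Function.uncurry U.toFun) (integrable_U U _) (M i j) ?_
    intro S T hS hT
    rw [setIntegral_prod _ (integrable_U U _).integrableOn, Measure.restrict_restrict hS,
      Measure.restrict_restrict hT]
    have h1 := hloc i j (S ∩ B i) (T ∩ B j) (hS.inter (hB i)) (hT.inter (hB j))
      Set.inter_subset_right Set.inter_subset_right
    simp only [measureReal_restrict_apply hS, measureReal_restrict_apply hT]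
    refine Eq.trans ?_ h1
    unfold FF
    congr 1
    funext x
    congr 1
    funext y
    exact U.symm' _ _
  refine ⟨M, hMs, ?_⟩
  have hall := ae_all_iff.2 fun i => ae_all_iff.2 fun j => hae i j
  filter_upwards [hall] with p hp
  exact hp _ _ ⟨rfl, rfl⟩

def stepK {k : ℕ} (π : I01 → Fin k) (hπ : Measurable π) (M : Fin k → Fin k → ℝ)
    (hM : ∀ i j, M i j = M j i) : GKernel where
  toFun x y := M (π x) (π y)
  measurable' := by
    have h : Measurable fun p : Fin k × Fin k => M p.1 p.2 := measurable_of_countable _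
    exact h.comp ((hπ.comp measurable_fst).prodMk (hπ.comp measurable_snd))
  bounded' := ⟨∑ i, ∑ j, |M i j|, fun x y => by
    refine le_trans ?_ (Finset.single_le_sum (f := fun i => ∑ j, |M i j|)
      (fun i _ => Finset.sum_nonneg fun j _ => abs_nonneg _) (Finset.mem_univ (π x)))
    exact Finset.single_le_sum (f := fun j => |M (π x) j|)
      (fun j _ => abs_nonneg _) (Finset.mem_univ (π y))⟩
  symm' x y := hM _ _

lemma map_pair {n : ℕ} {u v : Fin n} (huv : u ≠ v) :
    Measure.map (fun x : Fin n → I01 => (x u, x v)) volume =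
      (volume : Measure I01).prod (volume : Measure I01) := by
  have h := ProbabilityTheory.iIndepFun_pi (μ := fun _ : Fin n => (volume : Measure I01))
    (X := fun _ x => x) (fun _ => aemeasurable_id)
  have h2 := h.indepFun huv
  rw [ProbabilityTheory.indepFun_iff_map_prod_eq_prod_map_map (measurable_pi_apply u).aemeasurable
    (measurable_pi_apply v).aemeasurable] at h2
  rw [volume_pi, h2]
  congr 1
  · exact (measurePreserving_eval (fun _ : Fin n => (volume : Measure I01)) u).map_eq
  · exact (measurePreserving_eval (fun _ : Fin n => (volume : Measure I01)) v).map_eq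

lemma homDensity_congr {U W : GKernel}
    (h : ∀ᵐ p ∂((volume : Measure I01).prod (volume : Measure I01)),
      U.toFun p.1 p.2 = W.toFun p.1 p.2) {n : ℕ} (H : SimpleGraph (Fin n)) :
    homDensity H U = homDensity H W := by
  rw [homDensity_eq, homDensity_eq]
  refine integral_congr_ae ?_
  have key : ∀ e ∈ (Set.toFinite H.edgeSet).toFinset,
      ∀ᵐ x : Fin n → I01, ev U.toFun x e = ev W.toFun x e := by
    intro e he
    induction e using Sym2.ind with
    | _ u v =>
      have huv : u ≠ v := by
        have : H.Adj u v := by simpa using he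
        exact this.ne
      simp only [GKernel.ev_mk']
      rw [← map_pair huv] at h
      have hmeas : Measurable fun x : Fin n → I01 => (x u, x v) :=
        (measurable_pi_apply u).prodMk (measurable_pi_apply v)
      exact ae_of_ae_map hmeas.aemeasurable h
  have := (Filter.eventually_all_finset _).2 key
  filter_upwards [this] with x hx
  exact Finset.prod_congr rfl hx

lemma step_data {U : GKernel} {q : ℕ} (h : IsStepKernel U q) :
    ∃ (π : I01 → Fin q) (M : Fin q → Fin q → ℝ), Measurable π ∧ (∀ i j, M i j = M j i) ∧
      (∀ x y, U.toFun x y = M (π x) (π y)) ∧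
      (∀ i, 0 < (volume : Measure I01).real (π ⁻¹' {i})) ∧
      ∀ i j, i ≠ j → ∃ k, M i k ≠ M j k := by
  obtain ⟨⟨A, hA1, hA2, hA3, hA4, hA5⟩, hno⟩ := h
  have hex : ∀ x, ∃ i, x ∈ A i := fun x => by
    have : x ∈ ⋃ i, A i := hA4 ▸ Set.mem_univ x
    simpa using this
  choose π hπ using hex
  choose M hM using hA5
  have hpre : ∀ i, π ⁻¹' {i} = A i := by
    intro i
    ext x
    constructor
    · intro hx
      have : π x = i := hx
      exact this ▸ hπ x
    · intro hx
      by_contra hne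
      exact Set.disjoint_left.1 (hA3 hne) (hπ x) hx
  have hne : ∀ i, ∃ x, x ∈ A i := fun i => nonempty_of_measure_ne_zero (hA2 i).ne'
  have hpx : ∀ x i, x ∈ A i → π x = i := fun x i hx => by
    rw [← hpre i] at hx; exact hx
  have hUM : ∀ x y, U.toFun x y = M (π x) (π y) := fun x y => hM _ _ x (hπ x) y (hπ y)
  have hMs : ∀ i j, M i j = M j i := by
    intro i j
    obtain ⟨x, hx⟩ := hne i
    obtain ⟨y, hy⟩ := hne j
    rw [← hM i j x hx y hy, ← hM j i y hy x hx, U.symm']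
  have hπm : Measurable π := measurable_to_countable' fun i => by rw [hpre]; exact hA1 i
  refine ⟨π, M, hπm, hMs, hUM, ?_, ?_⟩
  · intro i
    rw [hpre]
    exact ENNReal.toReal_pos (hA2 i).ne' (measure_ne_top _ _)
  · intro i j hij
    by_contra hcon
    push Not at hcon
    apply hno
    obtain ⟨n, rfl⟩ : ∃ n, q = n + 1 := ⟨q - 1, by have := i.2; omega⟩
    change HasStepPartition U n
    let ρ : Fin (n + 1) → Fin (n + 1) := fun l => if l = i then j else l
    have hρM : ∀ l k, M (ρ l) k = M l k := by
      intro l k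
      by_cases hl : l = i
      · simp [ρ, hl, hcon k]
      · simp [ρ, hl]
    have hρi : ∀ l, ρ l ≠ i := by
      intro l
      by_cases hl : l = i
      · simp [ρ, hl, hij.symm]
      · simp [ρ, hl]
    refine ⟨fun l => (fun x => ρ (π x)) ⁻¹' {i.succAbove l}, ?_, ?_, ?_, ?_, ?_⟩
    · intro l
      have : Measurable fun x => ρ (π x) := (measurable_of_countable ρ).comp hπm
      exact this (measurableSet_singleton _)
    · intro l
      refine lt_of_lt_of_le (hA2 (i.succAbove l)) (measure_mono fun x hx => ?_)
      simp [hpx x _ hx, ρ, Fin.succAbove_ne]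
    · intro l l' hl
      rw [Set.disjoint_left]
      intro x hx hx'
      have h1 : ρ (π x) = i.succAbove l := hx
      have h2 : ρ (π x) = i.succAbove l' := hx'
      exact hl (Fin.succAbove_right_injective (h1.symm.trans h2))
    · refine Set.eq_univ_of_forall fun x => ?_
      obtain ⟨l, hl⟩ := Fin.exists_succAbove_eq (hρi (π x))
      exact Set.mem_iUnion.2 ⟨l, hl.symm⟩
    · intro l l'
      refine ⟨M (i.succAbove l) (i.succAbove l'), fun x hx y hy => ?_⟩
      have h1 : ρ (π x) = i.succAbove l := hx
      have h2 : ρ (π y) = i.succAbove l' := hy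
      rw [hUM, ← h1, ← h2, hρM, hMs, hMs (π x), hρM]

lemma fagree_of_step {U W : GKernel} {N : ℕ}
    (hagree : ∀ n : ℕ, n ≤ N → ∀ H : SimpleGraph (Fin n), homDensity H W = homDensity H U)
    {q k : ℕ} {π : I01 → Fin q} (hπ : Measurable π) {M : Fin q → Fin q → ℝ}
    (hU : ∀ x y, U.toFun x y = M (π x) (π y))
    {π' : I01 → Fin k} (hπ' : Measurable π') {M' : Fin k → Fin k → ℝ}
    (hW : ∀ x y, W.toFun x y = M' (π' x) (π' y)) :
    FAgree N (fun i => (volume : Measure I01).real (π ⁻¹' {i})) M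
      (fun i => (volume : Measure I01).real (π' ⁻¹' {i})) M' := by
  intro V _ inst hV E hE p hp
  have h := key_agree hagree hV hE hp
  simp only [ev_comp hU, ev_comp hW] at h
  rw [integral_step π (fun k => hπ (measurableSet_singleton k))
    (fun σ : V → Fin q => MvPolynomial.eval (ev M σ) p),
    integral_step π' (fun k => hπ' (measurableSet_singleton k))
    (fun σ : V → Fin k => MvPolynomial.eval (ev M' σ) p)] at h
  convert h.symm

lemma homDensity_step {U : GKernel} {q : ℕ} {π : I01 → Fin q} (hπ : Measurable π)
    {M : Fin q → Fin q → ℝ} (hU : ∀ x y, U.toFun x y = M (π x) (π y)) {n : ℕ}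
    (H : SimpleGraph (Fin n)) :
    homDensity H U = ∑ σ : Fin n → Fin q, (∏ v, (volume : Measure I01).real (π ⁻¹' {σ v})) *
      ∏ e ∈ (Set.toFinite H.edgeSet).toFinset, ev M σ e := by
  rw [homDensity_eq]
  simp only [ev_comp hU]
  have := integral_step π (fun k => hπ (measurableSet_singleton k))
    (fun σ : Fin n → Fin q => ∏ e ∈ (Set.toFinite H.edgeSet).toFinset, ev M σ e)
  convert this

lemma sum_measure_step {q : ℕ} {π : I01 → Fin q} (hπ : Measurable π) :
    ∑ i, (volume : Measure I01).real (π ⁻¹' {i}) = 1 := by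
  have h := integral_step (V := Unit) π (fun k => hπ (measurableSet_singleton k)) (fun _ => (1 : ℝ))
  simp only [integral_const, mul_one, Finset.univ_unique, Finset.prod_singleton] at h
  have h2 : ∑ σ : Unit → Fin q, (volume : Measure I01).real (π ⁻¹' {σ default}) =
      ∑ i, (volume : Measure I01).real (π ⁻¹' {i}) :=
    Fintype.sum_equiv (Equiv.funUnique Unit (Fin q)) _ _ fun σ => rfl
  rw [← h2]
  have h3 : (volume : Measure (Unit → I01)).real Set.univ = 1 := by simp
  rw [h3] at h
  simp only [smul_eq_mul, mul_one] at h
  convert h.symm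

theorem statement1 (q : ℕ) (hq : 2 ≤ q) (U U' : GKernel)
    (hstep : IsStepKernel U q)
    (hagree : ∀ n : ℕ, n ≤ 4 * q ^ 2 - q → ∀ H : SimpleGraph (Fin n),
      homDensity H U' = homDensity H U) :
    WeaklyIsomorphic U U' := by
  obtain ⟨π, M, hπ, hM, hU, hpos, htw⟩ := step_data hstep
  obtain ⟨k, hk, π', hπ', G, hG⟩ := exists_classes (ae_sep hq hagree π M hU)
  obtain ⟨M', hM', hae⟩ := ae_step U' hπ' hG
  have hWU' : ∀ (n : ℕ) (H : SimpleGraph (Fin n)),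
      homDensity H U' = homDensity H (stepK π' hπ' M' hM') := fun n H =>
    homDensity_congr (W := stepK π' hπ' M' hM') hae H
  have hF := fagree_of_step (U := U) (W := stepK π' hπ' M' hM') (N := 4 * q ^ 2 - q)
    (fun n hn H => by rw [← hWU', hagree n hn H]) hπ hU hπ' (fun _ _ => rfl)
  obtain ⟨τ, hτ1, hτ2⟩ := finite_concl hq hpos (sum_measure_step hπ) hM htw (κ := Fin k)
    (by simpa using hk) (fun _ => measureReal_nonneg) (sum_measure_step hπ') hM' hF
  intro n H
  rw [hWU', homDensity_step hπ hU, homDensity_step (U := stepK π' hπ' M' hM') hπ' (fun _ _ => rfl)]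
  refine Fintype.sum_equiv (Equiv.arrowCongr (Equiv.refl (Fin n)) τ) _ _ fun σ => ?_
  rw [ev_comp (W := M) (M := M') (f := τ) (fun x y => (hτ1 x y).symm)]
  simp only [← hτ2]
  rfl

end
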